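/- Let τ>0, 0<R<R₀, and let f be a 1-periodic real analytic function with zero mean value, not identically zero, extending holomorphically and boundedly to a neighbourhood of S̄_{R₀}. Let M > 2ζ(1+τ) and let ũ_M ∈ C¹_hol(K_M, B_{R,ρ}) be the function given by the complexified KAM theorem (possibly with a smaller ρ > 0). Let K̊_M^(i) := int(K_M) ∩ {q ∈ Ĉ : |q| < 1} and K̊_M^(e) := int(K_M) ∩ {q ∈ Ĉ : |q| > 1}, on each of which ũ_M is holomorphic. Then for every point q* of the unit circle 𝕊, there is no open connected set U ⊂ ℂ containing q* and intersecting K̊_M^(i) (respectively K̊_M^(e)), together with a holomorphic function g : U → B_{R,ρ} coinciding with ũ_M on a nonempty open subset of U ∩ K̊_M^(i) (respectively U ∩ K̊_M^(e)); i.e., the restriction of ũ_M to either component admits no analytic continuation in the Weierstraß sense in any neighbourhood of q*. -/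

import Mathlib

open Complex Metric Set OnePoint

noncomputable section

/-- Real Riemann zeta value `ζ(s) = Σ_{m≥1} m^{-s}` for real `s`. -/
def zetaR (s : ℝ) : ℝ := ∑' n : ℕ, 1 / (n + 1 : ℝ) ^ s

/-- The set `A_M^ℝ` of real `(2+τ)`-Diophantine numbers with constant `M`. -/
def AMR (τ M : ℝ) : Set ℝ :=
  {ω | ∀ n : ℤ, ∀ m : ℕ, 0 < m → 1 / (M * (m : ℝ) ^ (2 + τ)) ≤ |ω - n / m|}

/-- The complex extension `A_M^ℂ`. -/
def AMC (τ M : ℝ) : Set ℂ :=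
  {ω | ∃ ω₀ ∈ AMR τ M, |ω₀ - ω.re| ≤ |ω.im|}

/-- `E(ω) = e^{2πiω}`. -/
def Efn (ω : ℂ) : ℂ := Complex.exp (2 * Real.pi * Complex.I * ω)

/-- The compact set `K_M = E(A_M^ℂ) ∪ {0,∞}` in the Riemann sphere `Ĉ = ℂ ∪ {∞}`. -/
def KM (τ M : ℝ) : Set (OnePoint ℂ) :=
  (fun ω => ((Efn ω : ℂ) : OnePoint ℂ)) '' AMC τ M ∪ {((0 : ℂ) : OnePoint ℂ), ∞}

/-- The chart `ξ ↦ 1/ξ` of the Riemann sphere at `∞`. -/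
def sphChart (ξ : ℂ) : OnePoint ℂ := if ξ = 0 then ∞ else ((ξ⁻¹ : ℂ) : OnePoint ℂ)

/-- `K ∩ ℂ`, in the coordinate `q`. -/
def finPart (K : Set (OnePoint ℂ)) : Set ℂ := {q : ℂ | (q : OnePoint ℂ) ∈ K}
/-- `K̃ = {ξ : 1/ξ ∈ K}`, the set `K` read in the coordinate `ξ = 1/q`. -/
def infPart (K : Set (OnePoint ℂ)) : Set ℂ := {ξ : ℂ | sphChart ξ ∈ K}

variable {α : Type*} {B : Type*} [NormedAddCommGroup B] [NormedSpace ℂ B]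

/-- Difference quotient error `Ω_{u,g}(q,q') = (u(q')−u(q))/(q'−q) − g(q)`,
for functions with values in a space of functions on `α`. -/
def omegaF (u g : ℂ → α → B) (p : ℂ × ℂ) (a : α) : B :=
  if p.1 = p.2 then 0 else (p.2 - p.1)⁻¹ • (u p.2 a - u p.1 a) - g p.1 a

/-- Continuity on `K` for the sup-norm over `S` of the values. -/
def ContSup (K : Set ℂ) (S : Set α) (u : ℂ → α → B) : Prop :=
  ∀ q ∈ K, ∀ ε > (0 : ℝ), ∃ δ > (0 : ℝ), ∀ q' ∈ K, dist q' q < δ →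
    ∀ a ∈ S, ‖u q' a - u q a‖ ≤ ε

/-- Continuity on `K × K` for the sup-norm over `S` of the values. -/
def ContSup2 (K : Set ℂ) (S : Set α) (F : ℂ × ℂ → α → B) : Prop :=
  ∀ p ∈ K ×ˢ K, ∀ ε > (0 : ℝ), ∃ δ > (0 : ℝ), ∀ p' ∈ K ×ˢ K, dist p' p < δ →
    ∀ a ∈ S, ‖F p' a - F p a‖ ≤ ε

/-- `u` is `C¹`-holomorphic on `K ⊂ ℂ` with derivative `g`, with values in the
space of bounded functions on `S` (sup norm). -/
def FPair (K : Set ℂ) (S : Set α) (u g : ℂ → α → B) : Prop :=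
  ContSup K S u ∧ ContSup K S g ∧ ContSup2 K S (omegaF u g)

def fn0 (K : Set ℂ) (S : Set α) (u : ℂ → α → B) : ℝ :=
  sSup {x : ℝ | ∃ q ∈ K, ∃ a ∈ S, x = ‖u q a‖}
def fdel (K : Set ℂ) (S : Set α) (u : ℂ → α → B) : ℝ :=
  sSup {x : ℝ | ∃ p ∈ K ×ˢ K, ∃ a ∈ S, x = ‖u (Prod.snd p) a - u (Prod.fst p) a‖}
def fn2 (K : Set ℂ) (S : Set α) (u g : ℂ → α → B) : ℝ :=
  sSup {x : ℝ | ∃ p ∈ K ×ˢ K, ∃ a ∈ S, x = ‖omegaF u g p a‖}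

/-- The `C¹_hol` norm `n₀ + max(sup‖φ'‖, sup‖δφ‖) + n₂` (one chart). -/
def fNorm (K : Set ℂ) (S : Set α) (u g : ℂ → α → B) : ℝ :=
  fn0 K S u + max (fn0 K S g) (fdel K S u) + fn2 K S u g

def FBdd (K : Set ℂ) (S : Set α) (u g : ℂ → α → B) : Prop :=
  BddAbove {x : ℝ | ∃ q ∈ K, ∃ a ∈ S, x = ‖u q a‖} ∧
    BddAbove {x : ℝ | ∃ q ∈ K, ∃ a ∈ S, x = ‖g q a‖} ∧
    BddAbove {x : ℝ | ∃ p ∈ K ×ˢ K, ∃ a ∈ S, x = ‖omegaF u g p a‖}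

/-- `C¹`-holomorphy on a subset `K` of the Riemann sphere: `C¹`-holomorphy in
both charts `q` and `ξ = 1/q`, with chartwise derivatives `g` and `h`. -/
def SPair (K : Set (OnePoint ℂ)) (S : Set α) (u : OnePoint ℂ → α → B)
    (g h : ℂ → α → B) : Prop :=
  FPair (finPart K) S (fun q : ℂ => u (q : OnePoint ℂ)) g ∧
    FPair (infPart K) S (fun ξ : ℂ => u (sphChart ξ)) h

def SBdd (K : Set (OnePoint ℂ)) (S : Set α) (u : OnePoint ℂ → α → B)
    (g h : ℂ → α → B) : Prop :=
  FBdd (finPart K) S (fun q : ℂ => u (q : OnePoint ℂ)) g ∧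
    FBdd (infPart K) S (fun ξ : ℂ => u (sphChart ξ)) h

/-- The `C¹_hol(K,·)` norm for `K ⊂ Ĉ`: max of the norms in the two charts. -/
def sNorm (K : Set (OnePoint ℂ)) (S : Set α) (u : OnePoint ℂ → α → B)
    (g h : ℂ → α → B) : ℝ :=
  max (fNorm (finPart K) S (fun q : ℂ => u (q : OnePoint ℂ)) g)
    (fNorm (infPart K) S (fun ξ : ℂ => u (sphChart ξ)) h)

/-- The strip `S_r` (identified with `{x ∈ ℂ/ℤ : |Im x| < r}` via 1-periodicity). -/
def Strip (r : ℝ) : Set ℂ := {z : ℂ | |z.im| < r}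

/-- `S_r × D_ρ`, the domain of the elements of `B_{r,ρ} = H^∞(S_r × D_ρ)`. -/
def SD (r ρ : ℝ) : Set (ℂ × ℂ) := Strip r ×ˢ Metric.ball (0 : ℂ) ρ

/-- Membership of a value in `B_{r,ρ} = H^∞(S_r × D_ρ) = H^∞(S_r, B_ρ)`:
1-periodicity in `θ` and holomorphy on `S_r × D_ρ` (boundedness being part of
the `C¹_hol` data). -/
def ValHol (r ρ : ℝ) (v : ℂ × ℂ → ℂ) : Prop :=
  (∀ θ ε : ℂ, v (θ + 1, ε) = v (θ, ε)) ∧ DifferentiableOn ℂ v (SD r ρ)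

/-- `u ∈ C_r = C¹_hol(K_M, H^∞(S_r, B_ρ))`, with chartwise derivative data `g, h`. -/
def MemC (τ M r ρ : ℝ) (u : OnePoint ℂ → ℂ × ℂ → ℂ) (g h : ℂ → ℂ × ℂ → ℂ) : Prop :=
  SPair (KM τ M) (SD r ρ) u g h ∧ SBdd (KM τ M) (SD r ρ) u g h ∧
    ∀ q ∈ KM τ M, ValHol r ρ (u q)

/-- The norm `‖u‖_r` of `u ∈ C_r`, given its derivative data `g, h`. -/
def CNorm (τ M r ρ : ℝ) (u : OnePoint ℂ → ℂ × ℂ → ℂ) (g h : ℂ → ℂ × ℂ → ℂ) : ℝ :=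
  sNorm (KM τ M) (SD r ρ) u g h

/-- The `k`-th Fourier coefficient `φ̂_k(q) ∈ B_ρ` of `u(q) ∈ H^∞(S_r, B_ρ)`. -/
def fhat (u : OnePoint ℂ → ℂ × ℂ → ℂ) (k : ℤ) (q : OnePoint ℂ) (ε : ℂ) : ℂ :=
  ∫ t in (0:ℝ)..1, u q ((t : ℂ), ε) * Complex.exp (-(2 * Real.pi * Complex.I * k * t))

/-- `e_k(θ) = e^{2πikθ}`. -/
def ek (k : ℤ) (θ : ℂ) : ℂ := Complex.exp (2 * Real.pi * Complex.I * k * θ)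

/-- `up = u⁺`, i.e. `up(q,θ) = Σ_k q^k û_k(q) e_k(θ)` on `K_M` (for `q = e^{2πiω}`
this is `u(q, θ+ω)`). -/
def IsPlus (τ M r ρ : ℝ) (u up : OnePoint ℂ → ℂ × ℂ → ℂ) : Prop :=
  ∀ q : ℂ, (q : OnePoint ℂ) ∈ KM τ M → q ≠ 0 → ∀ θ ∈ Strip r,
    ∀ ε ∈ Metric.ball (0 : ℂ) ρ,
      HasSum (fun k : ℤ => q ^ k * fhat u k (q : OnePoint ℂ) ε * ek k θ)
        (up (q : OnePoint ℂ) (θ, ε))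

/-- `um = u⁻`, i.e. `um(q,θ) = Σ_k q^{-k} û_k(q) e_k(θ)`. -/
def IsMinus (τ M r ρ : ℝ) (u um : OnePoint ℂ → ℂ × ℂ → ℂ) : Prop :=
  ∀ q : ℂ, (q : OnePoint ℂ) ∈ KM τ M → q ≠ 0 → ∀ θ ∈ Strip r,
    ∀ ε ∈ Metric.ball (0 : ℂ) ρ,
      HasSum (fun k : ℤ => q ^ (-k) * fhat u k (q : OnePoint ℂ) ε * ek k θ)
        (um (q : OnePoint ℂ) (θ, ε))

/-- The derivative `∂_θ` acting on values. -/
def dth (v : OnePoint ℂ → ℂ × ℂ → ℂ) (q : OnePoint ℂ) (p : ℂ × ℂ) : ℂ :=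
  deriv (fun t => v q (t, p.2)) p.1

/-- Real-symmetry (`u ∈ C_{r,ℝ}`): `conj(û_k(q)) = û_{-k}(1/q̄)` where
`(conj ψ)(ε) = conj(ψ(ε̄))` in `B_ρ`. -/
def RealSym (τ M : ℝ) (u : OnePoint ℂ → ℂ × ℂ → ℂ) : Prop :=
  ∀ k : ℤ, ∀ q : ℂ, (q : OnePoint ℂ) ∈ KM τ M → q ≠ 0 → ∀ ε : ℂ,
    starRingEnd ℂ (fhat u k (q : OnePoint ℂ) (starRingEnd ℂ ε)) =
      fhat u (-k) (((((starRingEnd ℂ) q)⁻¹ : ℂ) : OnePoint ℂ)) ε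

/-- The part of the interior of `K_M` (in `Ĉ`) lying inside the unit circle,
`K̊_M^{(i)}`, viewed in the chart `q`. -/
def KMintIn (τ M : ℝ) : Set ℂ :=
  {q : ℂ | (q : OnePoint ℂ) ∈ interior (KM τ M) ∧ ‖q‖ < 1}

/-- The part of the interior of `K_M` lying outside the unit circle, `K̊_M^{(e)}`,
viewed in the chart `q`. -/
def KMintEx (τ M : ℝ) : Set ℂ :=
  {q : ℂ | (q : OnePoint ℂ) ∈ interior (KM τ M) ∧ 1 < ‖q‖}

/-- `g : U → B_{R,ρ}` is holomorphic on the open set `U ⊂ ℂ` as a map with values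
in the Banach space `B_{R,ρ} = H^∞(S_R × D_ρ)` (sup norm). -/
def BHolOn (R ρ : ℝ) (U : Set ℂ) (g : ℂ → ℂ × ℂ → ℂ) : Prop :=
  (∀ q ∈ U, ValHol R ρ (g q)) ∧
  (∀ q ∈ U, ∃ C : ℝ, ∀ pt ∈ SD R ρ, ‖g q pt‖ ≤ C) ∧
  ∃ g' : ℂ → ℂ × ℂ → ℂ, ∀ q ∈ U, ∀ ε > (0 : ℝ), ∃ δ > (0 : ℝ),
    ∀ q' ∈ U, dist q' q < δ → ∀ pt ∈ SD R ρ,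
      ‖g q' pt - g q pt - (q' - q) * g' q pt‖ ≤ ε * dist q' q

open MeasureTheory Filter Topology

theorem im_inv_ofReal_sub (t : ℝ) (z : ℂ) :
    (((t : ℂ) - z)⁻¹).im = z.im / ((t - z.re) ^ 2 + z.im ^ 2) := by
  rw [Complex.inv_im, normSq_apply]
  simp only [sub_im, ofReal_im, sub_re, ofReal_re]
  ring_nf

theorem integral_poissonKernel (x : ℝ) {y : ℝ} (hy : 0 < y) :
    Integrable (fun t : ℝ => y / ((t - x) ^ 2 + y ^ 2)) ∧
      ∫ t : ℝ, y / ((t - x) ^ 2 + y ^ 2) = Real.pi := by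
  have hne : y.toNNReal ≠ 0 := by simpa using hy
  have h : (fun t : ℝ => y / ((t - x) ^ 2 + y ^ 2)) =
      fun t => Real.pi * ProbabilityTheory.cauchyPDFReal x y.toNNReal t := by
    ext t
    rw [ProbabilityTheory.cauchyPDFReal_def, ← mul_assoc, ← mul_assoc,
      mul_inv_cancel₀ Real.pi_ne_zero, one_mul, Real.coe_toNNReal y hy.le, div_eq_mul_inv]
  rw [h]
  refine ⟨(ProbabilityTheory.integrable_cauchyPDFReal x).const_mul _, ?_⟩
  rw [integral_const_mul, ProbabilityTheory.integral_cauchyPDFReal_eq_one x hne, mul_one]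

theorem integral_Icc_poissonKernel (x : ℝ) {y r : ℝ} (hy : 0 < y) (hr : 0 ≤ r) :
    ∫ t in Icc (x - r) (x + r), y / ((t - x) ^ 2 + y ^ 2) = 2 * Real.arctan (r / y) := by
  rw [integral_Icc_eq_integral_Ioc, ← intervalIntegral.integral_of_le (by linarith)]
  rw [intervalIntegral.integral_eq_sub_of_hasDerivAt (f := fun t => Real.arctan ((t - x) / y))]
  · have h1 : (x + r - x) / y = r / y := by ring
    have h2 : (x - r - x) / y = -(r / y) := by ring
    rw [h1, h2, Real.arctan_neg]
    ring
  · intro t _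
    refine (((hasDerivAt_id' t).sub_const x).div_const y).arctan.congr_deriv ?_
    field_simp
    ring
  · exact (integral_poissonKernel x hy).1.intervalIntegrable

theorem setIntegral_poissonKernel_le_pi (S : Set ℝ) (x : ℝ) {y : ℝ} (hy : 0 < y) :
    ∫ t in S, y / ((t - x) ^ 2 + y ^ 2) ≤ Real.pi := by
  obtain ⟨h1, h2⟩ := integral_poissonKernel x hy
  rw [← h2]
  exact setIntegral_le_integral h1 (ae_of_all _ fun t => by positivity)

theorem setIntegral_poissonKernel_le_half_pi {S : Set ℝ} (x : ℝ) {y : ℝ}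
    (hy : 0 < y) (hdist : ∀ t ∈ S, y ≤ |t - x|) :
    ∫ t in S, y / ((t - x) ^ 2 + y ^ 2) ≤ Real.pi / 2 := by
  obtain ⟨h1, h2⟩ := integral_poissonKernel x hy
  have hI := integral_Icc_poissonKernel x hy hy.le
  rw [div_self hy.ne', Real.arctan_one, integral_Icc_eq_integral_Ioo] at hI
  have hdisj : Disjoint S (Ioo (x - y) (x + y)) := by
    rw [Set.disjoint_left]
    rintro t ht ⟨h3, h4⟩
    have := hdist t ht
    rw [le_abs] at this
    rcases this with h | h <;> linarith
  have hU := setIntegral_union hdisj measurableSet_Ioo h1.integrableOn h1.integrableOn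
  have := setIntegral_poissonKernel_le_pi (S ∪ Ioo (x - y) (x + y)) x hy
  linarith

theorem half_pi_lt_setIntegral_poissonKernel {S : Set ℝ} (hS : MeasurableSet S) {x r : ℝ}
    (hr : 0 < r) (hvol : volume.real (Icc (x - r) (x + r) \ S) ≤ r / 5) :
    Real.pi / 2 < ∫ t in S ∩ Icc (x - r) (x + r),
      (r / √3) / ((t - x) ^ 2 + (r / √3) ^ 2) := by
  have h3 : (0 : ℝ) < √3 := by positivity
  have h32 : √3 ^ 2 = 3 := Real.sq_sqrt (by norm_num)
  have h3' : √3 < 2 := by nlinarith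
  have hy : 0 < r / √3 := by positivity
  obtain ⟨h1, -⟩ := integral_poissonKernel x hy
  have hI := integral_Icc_poissonKernel x hy hr.le
  have he : r / (r / √3) = √3 := by field_simp
  rw [he, Real.arctan_sqrt_three] at hI
  have hsplit := integral_inter_add_sdiff (μ := volume) (s := Icc (x - r) (x + r)) hS
    h1.integrableOn
  have hfin : volume (Icc (x - r) (x + r) \ S) < ⊤ :=
    (measure_mono sdiff_subset).trans_lt measure_Icc_lt_top
  have hb := norm_setIntegral_le_of_norm_le_const (μ := volume) hfin
    (f := fun t : ℝ => (r / √3) / ((t - x) ^ 2 + (r / √3) ^ 2)) (C := √3 / r) (by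
      intro t _
      rw [Real.norm_of_nonneg (by positivity), div_le_div_iff₀ (by positivity) hr]
      have : √3 * (r / √3) ^ 2 = r / √3 * r := by field_simp
      nlinarith [sq_nonneg (t - x)])
  have hb2 := (le_abs_self _).trans hb
  have hb3 : √3 / r * volume.real (Icc (x - r) (x + r) \ S) ≤ √3 / 5 := by
    calc _ ≤ √3 / r * (r / 5) := by gcongr
      _ = √3 / 5 := by field_simp
  rw [Set.inter_comm]
  have hpi := Real.pi_gt_three
  linarith

theorem differentiableAt_cauchyTransform {S : Set ℝ} (hS : IsCompact S) {z : ℂ}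
    (hz : 0 < z.im) :
    DifferentiableAt ℂ (fun w : ℂ => ∫ t in S, ((t : ℂ) - w)⁻¹) z := by
  have hfin : volume S < ⊤ := hS.measure_lt_top
  have : IsFiniteMeasure (volume.restrict S) := ⟨by simpa using hfin⟩
  have hne : ∀ w ∈ ball z (z.im / 2), ∀ t : ℝ, z.im / 2 ≤ ‖(t : ℂ) - w‖ := by
    intro w hw t
    rw [mem_ball, dist_eq_norm] at hw
    have h1 := (abs_im_le_norm (w - z)).trans hw.le
    have h2 := abs_im_le_norm ((t : ℂ) - w)
    rw [sub_im, abs_le] at h1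
    rw [sub_im, ofReal_im, zero_sub, abs_neg] at h2
    have := le_abs_self w.im
    linarith
  have hmeas : ∀ w : ℂ, Measurable fun t : ℝ => ((t : ℂ) - w)⁻¹ := fun w => by fun_prop
  have hbd : ∀ w ∈ ball z (z.im / 2), ∀ t : ℝ, ‖((t : ℂ) - w)⁻¹‖ ≤ (z.im / 2)⁻¹ := by
    intro w hw t
    rw [norm_inv]
    exact inv_anti₀ (by positivity) (hne w hw t)
  refine (hasDerivAt_integral_of_dominated_loc_of_deriv_le (𝕜 := ℂ)
    (μ := volume.restrict S) (F := fun (w : ℂ) (t : ℝ) => ((t : ℂ) - w)⁻¹)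
    (s := ball z (z.im / 2)) (bound := fun _ => ((z.im / 2)⁻¹) ^ 2)
    (F' := fun w t => (((t : ℂ) - w)⁻¹) ^ 2)
    (ball_mem_nhds z (by positivity)) ?_ ?_ ?_ ?_ ?_ ?_).2.differentiableAt
  · exact Eventually.of_forall fun w => (hmeas w).aestronglyMeasurable
  · exact Integrable.of_bound (hmeas z).aestronglyMeasurable _
      (ae_of_all _ fun t => hbd z (mem_ball_self (by positivity)) t)
  · exact ((hmeas z).pow_const 2).aestronglyMeasurable
  · refine ae_of_all _ fun t w hw => ?_
    rw [norm_pow]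
    exact pow_le_pow_left₀ (norm_nonneg _) (hbd w hw t) 2
  · exact integrable_const _
  · refine ae_of_all _ fun t w hw => ?_
    have hw' : (t : ℂ) - w ≠ 0 := by
      rw [← norm_pos_iff]
      have := hne w hw t
      linarith
    refine (((hasDerivAt_id' w).const_sub (t : ℂ)).fun_inv hw').congr_deriv ?_
    simp only [neg_neg, one_div, inv_pow]

theorem cauchyTransform_im {S : Set ℝ} (hS : IsCompact S) {z : ℂ} (hz : 0 < z.im) :
    (∫ t in S, ((t : ℂ) - z)⁻¹).im = ∫ t in S, z.im / ((t - z.re) ^ 2 + z.im ^ 2) := by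
  have hfin : volume S < ⊤ := hS.measure_lt_top
  have : IsFiniteMeasure (volume.restrict S) := ⟨by simpa using hfin⟩
  have hint : Integrable (fun t : ℝ => ((t : ℂ) - z)⁻¹) (volume.restrict S) := by
    refine Integrable.of_bound (C := z.im⁻¹) (by fun_prop) (ae_of_all _ fun t => ?_)
    rw [norm_inv]
    refine inv_anti₀ hz ?_
    have h2 := abs_im_le_norm ((t : ℂ) - z)
    rw [sub_im, ofReal_im, zero_sub, abs_neg] at h2
    exact (le_abs_self _).trans h2
  have h := integral_im (𝕜 := ℂ) hint
  simp only [RCLike.im_eq_complex_im] at h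
  rw [← h]
  simp only [im_inv_ofReal_sub]

theorem exists_density_interval {A : Set ℝ} (hA : IsClosed A) (hpos : 0 < volume A) :
    ∃ x ∈ A, ∃ r > 0, volume.real (Icc (x - r) (x + r) \ A) ≤ r / 5 := by
  have hne : volume.restrict A ≠ 0 := by
    rw [Ne, Measure.restrict_eq_zero]
    exact hpos.ne'
  have hne' : (ae (volume.restrict A)).NeBot := ae_neBot.2 hne
  obtain ⟨x, hx, hxA⟩ := ((Besicovitch.ae_tendsto_measure_inter_div volume A).and
    (ae_restrict_mem hA.measurableSet)).exists
  have h1 : ∀ᶠ r in 𝓝[>] (0 : ℝ),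
      ENNReal.ofReal (9 / 10) < volume (A ∩ closedBall x r) / volume (closedBall x r) :=
    hx.eventually (lt_mem_nhds (by
      rw [← ENNReal.ofReal_one]
      exact (ENNReal.ofReal_lt_ofReal_iff one_pos).2 (by norm_num)))
  obtain ⟨r, hr, hr0⟩ := (h1.and self_mem_nhdsWithin).exists
  have hr0 : 0 < r := hr0
  refine ⟨x, hxA, r, hr0, ?_⟩
  rw [Real.closedBall_eq_Icc, Real.volume_Icc] at hr
  have h2 : x + r - (x - r) = 2 * r := by ring
  rw [h2] at hr
  have h3 : ENNReal.ofReal (9 / 10) * ENNReal.ofReal (2 * r) ≤ volume (A ∩ Icc (x - r) (x + r)) := by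
    have := ENNReal.mul_le_of_le_div hr.le
    exact this
  rw [← ENNReal.ofReal_mul (by norm_num)] at h3
  have hfin : volume (A ∩ Icc (x - r) (x + r)) ≠ ⊤ :=
    ((measure_mono inter_subset_right).trans_lt measure_Icc_lt_top).ne
  have h4 : 9 / 10 * (2 * r) ≤ volume.real (A ∩ Icc (x - r) (x + r)) :=
    (ENNReal.ofReal_le_iff_le_toReal hfin).1 h3
  have h5 := measureReal_inter_add_sdiff (μ := volume) (s := Icc (x - r) (x + r))
    hA.measurableSet measure_Icc_lt_top.ne
  rw [Real.volume_real_Icc_of_le (by linarith), inter_comm, h2] at h5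
  linarith

theorem isPreconnected_strict_epigraph {d : ℝ → ℝ} (hd : Continuous d) :
    IsPreconnected {z : ℂ | d z.re < z.im} := by
  have h : {z : ℂ | d z.re < z.im} =
      (fun p : ℝ × ℝ => (⟨p.1, d p.1 + p.2⟩ : ℂ)) '' ((univ : Set ℝ) ×ˢ Ioi (0 : ℝ)) := by
    ext z
    constructor
    · intro hz
      refine ⟨(z.re, z.im - d z.re), ⟨mem_univ _, ?_⟩, ?_⟩
      · simpa using hz
      · apply Complex.ext <;> simp
    · rintro ⟨p, ⟨-, hp⟩, rfl⟩
      have hp : 0 < p.2 := hp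
      simpa using hp
  rw [h]
  refine (isPreconnected_univ.prod isPreconnected_Ioi).image _ (Continuous.continuousOn ?_)
  have : (fun p : ℝ × ℝ => (⟨p.1, d p.1 + p.2⟩ : ℂ)) =
      fun p => (p.1 : ℂ) + ((d p.1 + p.2 : ℝ) : ℂ) * I := by
    ext p
    apply Complex.ext <;> simp
  rw [this]
  fun_prop

/-- Harmonic-measure estimate: a function which is holomorphic above the graph of the distance to
a compact set `S ⊂ ℝ`, continuous up to the graph, and zero on `S`, vanishes wherever `S` is seen
under an angle larger than `π / 2`. -/
theorem eq_zero_of_half_pi_lt_cauchyTransform {S : Set ℝ} (hS : IsCompact S) (hne : S.Nonempty)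
    {Z : ℂ → ℂ} (hZ : DifferentiableOn ℂ Z {z | infDist z.re S ≤ z.im})
    (h0 : ∀ a ∈ S, Z a = 0) {w : ℂ} (hw : infDist w.re S < w.im)
    (hw2 : Real.pi / 2 < (∫ t in S, ((t : ℂ) - w)⁻¹).im) : Z w = 0 := by
  set H : ℂ → ℂ := fun w => ∫ t in S, ((t : ℂ) - w)⁻¹ with hH
  have hHd : ∀ z : ℂ, 0 < z.im → DifferentiableAt ℂ H z := fun z hz =>
    differentiableAt_cauchyTransform hS hz
  have hHpi : ∀ z : ℂ, 0 < z.im → (H z).im ≤ Real.pi := fun z hz => by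
    rw [hH]
    simp only
    rw [cauchyTransform_im hS hz]
    exact setIntegral_poissonKernel_le_pi S _ hz
  obtain ⟨a, ha0, ha⟩ : ∃ a : ℝ, 0 < a ∧ ∀ t ∈ S, ‖t‖ ≤ a := by
    obtain ⟨a, ha⟩ := hS.isBounded.exists_norm_le
    exact ⟨max a 1, by positivity, fun t ht => (ha t ht).trans (le_max_left _ _)⟩
  set v := volume.real S
  have hv : 0 ≤ v := measureReal_nonneg
  set r : ℝ := ‖w‖ + a + v + 1 with hr
  have hHr : ∀ z : ℂ, r ≤ ‖z‖ → (H z).im ≤ Real.pi / 2 := by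
    intro z hz
    have hb := norm_setIntegral_le_of_norm_le_const (μ := volume) (s := S)
      hS.measure_lt_top (f := fun t : ℝ => ((t : ℂ) - z)⁻¹) (C := (v + 1)⁻¹) (by
        intro t ht
        rw [norm_inv]
        refine inv_anti₀ (by positivity) ?_
        have h1 := norm_sub_norm_le z (t : ℂ)
        rw [norm_sub_rev] at h1
        have h2 := ha t ht
        rw [norm_real] at h1
        have := norm_nonneg w
        linarith)
    have h2 := (le_abs_self _).trans ((abs_im_le_norm (H z)).trans hb)
    have h3 : (v + 1)⁻¹ * v ≤ 1 := by
      rw [inv_mul_le_iff₀ (by positivity)]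
      linarith
    have := Real.pi_gt_three
    linarith
  set Ω : Set ℂ := {z | infDist z.re S < z.im} ∩ ball 0 r with hΩ
  have hcd : Continuous fun z : ℂ => infDist z.re S := (continuous_infDist_pt S).comp continuous_re
  have hΩo : IsOpen Ω := (isOpen_lt hcd continuous_im).inter isOpen_ball
  have hcl : closure Ω ⊆ {z | infDist z.re S ≤ z.im} :=
    closure_minimal (fun z hz => (show infDist z.re S < z.im from hz.1).le) (isClosed_le hcd continuous_im)
  have hbdd : Bornology.IsBounded Ω := isBounded_ball.subset inter_subset_right
  obtain ⟨C, hC⟩ : ∃ C, ∀ z ∈ closure Ω, ‖Z z‖ ≤ C :=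
    (hbdd.isCompact_closure).exists_bound_of_continuousOn (hZ.continuousOn.mono hcl)
  have hwΩ : w ∈ Ω := ⟨hw, by rw [mem_ball_zero_iff]; linarith⟩
  have hC0 : 0 ≤ C := (norm_nonneg _).trans (hC w (subset_closure hwΩ))
  have hreal : ∀ z ∈ closure Ω, ¬ 0 < z.im → Z z = 0 := by
    intro z hz hz0
    have h1 : infDist z.re S ≤ z.im := hcl hz
    have h2 : 0 ≤ infDist z.re S := infDist_nonneg
    have h3 : infDist z.re S = 0 := by linarith
    have h4 : z.re ∈ S := (hS.isClosed.mem_iff_infDist_zero hne).2 h3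
    have h5 : z = (z.re : ℂ) := Complex.ext (by simp) (by simp; linarith)
    rw [h5]
    exact h0 _ h4
  have key : ∀ n : ℕ, ‖Z w‖ * Real.exp (n * ((H w).im - Real.pi / 2)) ≤ C := by
    intro n
    set P : ℂ → ℂ := fun z => Z z * Complex.exp (n * (-I * H z - (Real.pi / 2 : ℝ))) with hP
    set G : ℂ → ℂ := fun z => if 0 < z.im then P z else 0 with hG
    have hPn : ∀ z, ‖P z‖ = ‖Z z‖ * Real.exp (n * ((H z).im - Real.pi / 2)) := by
      intro z
      rw [hP]
      simp only [norm_mul, Complex.norm_exp]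
      congr 2
      rw [← ofReal_natCast, re_ofReal_mul]
      simp
    have hGP : ∀ z : ℂ, 0 < z.im → G =ᶠ[𝓝 z] P := by
      intro z hz
      filter_upwards [continuous_im.isOpen_preimage _ isOpen_Ioi |>.mem_nhds hz] with y hy
      have hy : 0 < y.im := hy
      simp [hG, hy]
    have hdc : DiffContOnCl ℂ G Ω := by
      constructor
      · intro z hz
        have hz0 : 0 < z.im := infDist_nonneg.trans_lt hz.1
        have hZz : DifferentiableAt ℂ Z z := hZ.differentiableAt
          (mem_of_superset (hΩo.mem_nhds hz) (subset_closure.trans hcl))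
        have hPz : DifferentiableAt ℂ P z := by
          have := hHd z hz0
          fun_prop
        exact ((hGP z hz0).differentiableAt_iff.2 hPz).differentiableWithinAt
      · intro z hz
        by_cases hz0 : 0 < z.im
        · have hZz : ContinuousWithinAt Z (closure Ω) z := (hZ.continuousOn.mono hcl) z hz
          have hHz : ContinuousWithinAt H (closure Ω) z := (hHd z hz0).continuousAt.continuousWithinAt
          have hPz : ContinuousWithinAt P (closure Ω) z := by
            refine hZz.mul ?_
            fun_prop
          refine hPz.congr_of_eventuallyEq ?_ (hGP z hz0).self_of_nhds
          exact (hGP z hz0).filter_mono nhdsWithin_le_nhds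
        · have hGz : G z = 0 := by simp [hG, hz0]
          have hZz : ContinuousWithinAt Z (closure Ω) z := (hZ.continuousOn.mono hcl) z hz
          have hZ0 := hreal z hz hz0
          rw [ContinuousWithinAt, hZ0] at hZz
          rw [ContinuousWithinAt, hGz]
          have h1 : Tendsto (fun y => ‖Z y‖ * Real.exp (n * (Real.pi / 2))) (𝓝[closure Ω] z)
              (𝓝 0) := by
            simpa using hZz.norm.mul_const (Real.exp (n * (Real.pi / 2)))
          refine squeeze_zero_norm' ?_ h1
          filter_upwards with y
          by_cases hy : 0 < y.im
          · have : G y = P y := by simp [hG, hy]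
            rw [this, hPn]
            have := hHpi y hy
            gcongr
            linarith
          · have : G y = 0 := by simp [hG, hy]
            rw [this, norm_zero]
            positivity
    have hfr : ∀ z ∈ frontier Ω, ‖G z‖ ≤ C := by
      intro z hz
      by_cases hz0 : 0 < z.im
      · have hzc := frontier_subset_closure hz
        have hzn : z ∉ Ω := by
          rw [hΩo.frontier_eq] at hz
          exact hz.2
        have hle : (H z).im ≤ Real.pi / 2 := by
          by_cases hzr : ‖z‖ < r
          · have h1 : z.im ≤ infDist z.re S := by
              by_contra h
              exact hzn ⟨not_le.1 h, by rwa [mem_ball_zero_iff]⟩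
            rw [hH]
            simp only
            rw [cauchyTransform_im hS hz0]
            refine setIntegral_poissonKernel_le_half_pi _ hz0 fun t ht => ?_
            have := infDist_le_dist_of_mem (x := z.re) ht
            rw [dist_comm, Real.dist_eq] at this
            linarith
          · exact hHr z (not_lt.1 hzr)
        have : G z = P z := by simp [hG, hz0]
        rw [this, hPn]
        calc _ ≤ C * 1 := by
              gcongr
              · exact hC z hzc
              · rw [Real.exp_le_one_iff]
                exact mul_nonpos_of_nonneg_of_nonpos (Nat.cast_nonneg n) (by linarith)
          _ = C := mul_one C
      · have : G z = 0 := by simp [hG, hz0]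
        rw [this, norm_zero]
        exact hC0
    have := norm_le_of_forall_mem_frontier_norm_le hbdd hdc hfr (subset_closure hwΩ)
    have hw0 : 0 < w.im := infDist_nonneg.trans_lt hw
    have h2 : G w = P w := by simp [hG, hw0]
    rwa [h2, hPn] at this
  by_contra hZw
  have hZw' : 0 < ‖Z w‖ := norm_pos_iff.2 hZw
  have ht : Tendsto (fun n : ℕ => ‖Z w‖ * Real.exp (n * ((H w).im - Real.pi / 2))) atTop atTop := by
    refine Tendsto.const_mul_atTop hZw' (Real.tendsto_exp_atTop.comp ?_)
    exact tendsto_natCast_atTop_atTop.atTop_mul_const (by linarith)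
  obtain ⟨n, hn⟩ := (ht.eventually (eventually_gt_atTop C)).exists
  exact absurd (key n) (not_le.2 hn)

/-- Boundary uniqueness from a closed set of positive measure. -/
theorem eq_zero_of_zero_on_pos_measure {A : Set ℝ} (hA : IsClosed A) (hpos : 0 < volume A)
    {Z : ℂ → ℂ} (hZ : DifferentiableOn ℂ Z {z | infDist z.re A ≤ z.im})
    (h0 : ∀ a ∈ A, Z a = 0) {z : ℂ} (hz : infDist z.re A ≤ z.im) : Z z = 0 := by
  obtain ⟨x, hxA, r, hr, hvol⟩ := exists_density_interval hA hpos
  set S := A ∩ Icc (x - r) (x + r) with hSdef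
  have hS : IsCompact S := isCompact_Icc.inter_left hA
  have hxS : x ∈ S := ⟨hxA, by linarith, by linarith⟩
  have hsub : ∀ y : ℝ, infDist y A ≤ infDist y S := fun y =>
    infDist_le_infDist_of_subset inter_subset_left ⟨x, hxS⟩
  set z₀ : ℂ := ⟨x, r / √3⟩ with hz₀
  have hz₀im : 0 < z₀.im := by
    change 0 < r / √3
    positivity
  have hz₀S : infDist z₀.re S < z₀.im := by
    rw [show infDist z₀.re S = 0 from infDist_zero_of_mem hxS]
    exact hz₀im
  have hz₀H : Real.pi / 2 < (∫ t in S, ((t : ℂ) - z₀)⁻¹).im := by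
    rw [cauchyTransform_im hS hz₀im]
    exact half_pi_lt_setIntegral_poissonKernel hA.measurableSet hr hvol
  have hcS : Continuous fun z : ℂ => infDist z.re S := (continuous_infDist_pt S).comp continuous_re
  have hcA : Continuous fun z : ℂ => infDist z.re A := (continuous_infDist_pt A).comp continuous_re
  have hev : Z =ᶠ[𝓝 z₀] 0 := by
    have h1 : ∀ᶠ z in 𝓝 z₀, Real.pi / 2 < (∫ t in S, ((t : ℂ) - z)⁻¹).im :=
      (continuous_im.continuousAt.comp
        (differentiableAt_cauchyTransform hS hz₀im).continuousAt).eventually (lt_mem_nhds hz₀H)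
    have h2 : ∀ᶠ z in 𝓝 z₀, infDist z.re S < z.im :=
      (isOpen_lt hcS continuous_im).mem_nhds hz₀S
    filter_upwards [h1, h2] with z hz1 hz2
    exact eq_zero_of_half_pi_lt_cauchyTransform hS ⟨x, hxS⟩
      (hZ.mono fun y hy => (hsub y.re).trans hy) (fun a ha => h0 a ha.1) hz2 hz1
  have hWo : IsOpen {z : ℂ | infDist z.re A < z.im} := isOpen_lt hcA continuous_im
  have hsub' : {z : ℂ | infDist z.re A < z.im} ⊆ {z : ℂ | infDist z.re A ≤ z.im} :=
    fun y hy => (show infDist y.re A < y.im from hy).le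
  have hW : EqOn Z 0 {z : ℂ | infDist z.re A < z.im} :=
    ((hZ.mono hsub').analyticOnNhd
      hWo).eqOn_zero_of_preconnected_of_eventuallyEq_zero
      (isPreconnected_strict_epigraph (continuous_infDist_pt A)) ((hsub _).trans_lt hz₀S) hev
  refine hW.of_subset_closure hZ.continuousOn continuousOn_const hsub' ?_ hz
  intro y hy
  have hlim : Tendsto (fun s : ℝ => y + s * I) (𝓝[>] 0) (𝓝 y) := by
    have : Continuous fun s : ℝ => y + s * I := by fun_prop
    simpa using (this.tendsto 0).mono_left nhdsWithin_le_nhds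
  refine mem_closure_of_tendsto hlim ?_
  filter_upwards [self_mem_nhdsWithin] with s hs
  have hs : 0 < s := hs
  have hy : infDist y.re A ≤ y.im := hy
  simp
  linarith

theorem summable_zetaR {s : ℝ} (hs : 1 < s) : Summable fun n : ℕ => 1 / (n + 1 : ℝ) ^ s := by
  have := (summable_nat_add_iff 1).2 (Real.summable_one_div_nat_rpow.2 hs)
  simpa using this

theorem one_le_zetaR {s : ℝ} (hs : 1 < s) : 1 ≤ zetaR s := by
  have h := (summable_zetaR hs).le_tsum 0 (fun n _ => by positivity)
  simpa [zetaR] using h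

theorem isClosed_AMR (τ M : ℝ) : IsClosed (AMR τ M) := by
  have : AMR τ M = ⋂ (n : ℤ) (m : ℕ) (_ : 0 < m),
      {ω : ℝ | 1 / (M * (m : ℝ) ^ (2 + τ)) ≤ |ω - n / m|} := by
    ext ω
    simp [AMR]
  rw [this]
  refine isClosed_iInter fun n => isClosed_iInter fun m => isClosed_iInter fun _ => ?_
  exact isClosed_le continuous_const (by fun_prop)

theorem neg_mem_AMR {τ M ω : ℝ} (h : ω ∈ AMR τ M) : -ω ∈ AMR τ M := by
  intro n m hm
  have := h (-n) m hm
  rw [← abs_neg]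
  convert this using 2
  push_cast
  ring

theorem Efn_pow (ω : ℂ) (k : ℕ) : Efn ω ^ k = Complex.exp (2 * Real.pi * I * (k * ω)) := by
  rw [Efn, ← Complex.exp_nat_mul]
  ring_nf

theorem Efn_pow_ne_one {τ M ω : ℝ} (hM : 0 < M) (h : ω ∈ AMR τ M) {k : ℕ} (hk : 0 < k) :
    Efn (ω : ℂ) ^ k ≠ 1 := by
  rw [Efn_pow, Ne, Complex.exp_eq_one_iff]
  rintro ⟨n, hn⟩
  have h1 : ((k : ℂ) * ω) = n := by
    have h2 : (2 * Real.pi * I : ℂ) ≠ 0 := Complex.two_pi_I_ne_zero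
    apply mul_left_cancel₀ h2
    rw [hn]
    ring
  have h2 : (k : ℝ) * ω = n := by exact_mod_cast h1
  have h3 := h n k hk
  have hk' : (0 : ℝ) < k := by exact_mod_cast hk
  have h4 : ω - n / k = 0 := by
    rw [← h2]
    field_simp
    ring
  rw [h4, abs_zero] at h3
  have : 0 < 1 / (M * (k : ℝ) ^ (2 + τ)) := by positivity
  linarith

theorem Icc_subset_AMR_union {τ M : ℝ} (hτ : 0 < τ) (hM : 1 ≤ M) (N : ℕ) :
    Icc (0 : ℝ) N ⊆ AMR τ M ∪ ⋃ k : ℕ, ⋃ n ∈ Finset.Icc (-1 : ℤ) ((k + 1) * N + 1),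
      ball ((n : ℝ) / (k + 1)) (1 / (M * (k + 1 : ℝ) ^ (2 + τ))) := by
  intro ω hω
  by_cases hA : ω ∈ AMR τ M
  · exact Or.inl hA
  right
  simp only [AMR, mem_ofPred_eq, not_forall, not_le] at hA
  obtain ⟨n, m, hm, h⟩ := hA
  obtain ⟨k, rfl⟩ := Nat.exists_eq_succ_of_ne_zero hm.ne'
  simp only [Nat.succ_eq_add_one, Nat.cast_add, Nat.cast_one] at h
  have hk : (0 : ℝ) < k + 1 := by positivity
  have hr : 1 / (M * (k + 1 : ℝ) ^ (2 + τ)) ≤ 1 / (k + 1) := by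
    refine one_div_le_one_div_of_le hk ?_
    have h1 : (k + 1 : ℝ) ^ (1 : ℝ) ≤ (k + 1 : ℝ) ^ (2 + τ) :=
      Real.rpow_le_rpow_of_exponent_le (by linarith [(Nat.cast_nonneg k : (0 : ℝ) ≤ k)])
        (by linarith)
    rw [Real.rpow_one] at h1
    nlinarith
  have h2 := abs_lt.1 (h.trans_le hr)
  have h3 : ω - n / (k + 1) = (ω * (k + 1) - n) / (k + 1) := by field_simp
  have h4 : -(1 / (k + 1 : ℝ)) = (-1) / (k + 1) := by ring
  rw [h3, h4, div_lt_div_iff_of_pos_right hk, div_lt_div_iff_of_pos_right hk] at h2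
  obtain ⟨h5, h6⟩ := h2
  simp only [mem_iUnion, Finset.mem_Icc]
  refine ⟨k, n, ⟨?_, ?_⟩, ?_⟩
  · have : (-1 : ℝ) < n := by nlinarith [hω.1]
    have : (-1 : ℤ) < n := by exact_mod_cast this
    exact this.le
  · have : (n : ℝ) ≤ (k + 1) * N + 1 := by nlinarith [hω.2]
    exact_mod_cast this
  · rw [mem_ball, Real.dist_eq]
    exact h

theorem volume_AMR_pos {τ M : ℝ} (hτ : 0 < τ) (hM : 2 * zetaR (1 + τ) < M) :
    0 < volume (AMR τ M) := by
  have hz1 := one_le_zetaR (s := 1 + τ) (by linarith)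
  have hM0 : 0 < M := by linarith
  obtain ⟨N, hN⟩ := exists_nat_gt (6 * zetaR (2 + τ) / (M - 2 * zetaR (1 + τ)))
  rw [div_lt_iff₀ (by linarith)] at hN
  by_contra h0
  have h0 : volume (AMR τ M) = 0 := by simpa using h0
  have hcover := measure_mono (μ := volume)
    (Icc_subset_AMR_union (τ := τ) (M := M) hτ (by linarith) N)
  set r : ℕ → ℝ := fun k => 1 / (M * (k + 1 : ℝ) ^ (2 + τ)) with hr
  have hr0 : ∀ k, 0 ≤ r k := fun k => by rw [hr]; positivity
  have hsum : HasSum (fun k : ℕ => ((k + 1) * N + 3 : ℝ) * (2 * r k))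
      (2 / M * (N * zetaR (1 + τ) + 3 * zetaR (2 + τ))) := by
    have h1 := ((summable_zetaR (s := 1 + τ) (by linarith)).hasSum.mul_left (N : ℝ))
    have h2 := ((summable_zetaR (s := 2 + τ) (by linarith)).hasSum.mul_left (3 : ℝ))
    have h := (h1.add h2).mul_left (2 / M)
    have he : (fun k : ℕ => ((k + 1) * N + 3 : ℝ) * (2 * r k)) = fun k : ℕ =>
        2 / M * (N * (1 / (k + 1 : ℝ) ^ (1 + τ)) + 3 * (1 / (k + 1 : ℝ) ^ (2 + τ))) := by
      ext k
      have hk : (0 : ℝ) < k + 1 := by positivity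
      have h3 : (k + 1 : ℝ) ^ (2 + τ) = (k + 1) * (k + 1 : ℝ) ^ (1 + τ) := by
        rw [show 2 + τ = 1 + (1 + τ) by ring, Real.rpow_add hk 1, Real.rpow_one]
      have h5 : (0 : ℝ) < (k + 1 : ℝ) ^ (1 + τ) := by positivity
      rw [hr]
      simp only
      rw [h3]
      field_simp
    rw [he]
    exact h
  have hmeas : volume (⋃ k : ℕ, ⋃ n ∈ Finset.Icc (-1 : ℤ) ((k + 1) * N + 1),
      ball ((n : ℝ) / (k + 1)) (1 / (M * (k + 1 : ℝ) ^ (2 + τ)))) ≤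
      ENNReal.ofReal (2 / M * (N * zetaR (1 + τ) + 3 * zetaR (2 + τ))) := by
    refine (measure_iUnion_le _).trans ?_
    rw [← hsum.tsum_eq, ENNReal.ofReal_tsum_of_nonneg
      (fun k => mul_nonneg (by positivity) (mul_nonneg zero_le_two (hr0 k))) hsum.summable]
    refine ENNReal.tsum_le_tsum fun k => ?_
    refine (measure_biUnion_finset_le _ _).trans ?_
    simp only [Real.volume_ball, Finset.sum_const, Int.card_Icc]
    have : ((k + 1 : ℤ) * N + 1 + 1 - -1).toNat = (k + 1) * N + 3 := by
      have : ((k + 1 : ℤ) * N + 1 + 1 - -1) = (((k + 1) * N + 3 : ℕ) : ℤ) := by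
        push_cast
        ring
      rw [this, Int.toNat_natCast]
    rw [this, nsmul_eq_mul, ← ENNReal.ofReal_natCast, ← ENNReal.ofReal_mul (Nat.cast_nonneg _)]
    push_cast
    rfl
  have hfin := hcover.trans ((measure_union_le _ _).trans
    (add_le_add h0.le hmeas))
  rw [zero_add, Real.volume_Icc, sub_zero] at hfin
  have hz2 : 0 ≤ zetaR (2 + τ) := by linarith [one_le_zetaR (s := 2 + τ) (by linarith)]
  rw [ENNReal.ofReal_le_ofReal_iff (by positivity)] at hfin
  rw [div_mul_eq_mul_div, le_div_iff₀ hM0] at hfin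
  nlinarith

/-- The `k`-th Fourier coefficient as a continuous linear functional on `C(𝕋, ℂ)`. -/
def fourierFunctional (k : ℤ) : C(UnitAddCircle, ℂ) →L[ℂ] ℂ :=
  LinearMap.mkContinuous
    { toFun := fun φ => fourierCoeff φ k
      map_add' := fun φ ψ => congrFun (fourierCoeff.add
        (φ.continuous.integrable_of_hasCompactSupport (HasCompactSupport.of_compactSpace _))
        (ψ.continuous.integrable_of_hasCompactSupport (HasCompactSupport.of_compactSpace _))) k
      map_smul' := fun c φ => fourierCoeff.const_smul φ c k }
    1 fun φ => by
      have h : ∀ x : UnitAddCircle, ‖fourier (-k) x • φ x‖ ≤ 1 * ‖φ‖ := fun x => by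
        rw [norm_smul]
        gcongr
        · rw [fourier_apply, Circle.norm_coe]
        · exact φ.norm_coe_le_norm x
      have := norm_integral_le_of_norm_le_const (μ := AddCircle.haarAddCircle)
        (Eventually.of_forall h)
      simpa [fourierCoeff] using this

theorem fourierFunctional_apply (k : ℤ) (φ : C(UnitAddCircle, ℂ)) :
    fourierFunctional k φ = fourierCoeff φ k := rfl

theorem fourierFunctional_eq_intervalIntegral (k : ℤ) (φ : C(UnitAddCircle, ℂ)) :
    fourierFunctional k φ =
      ∫ t in (0 : ℝ)..1, Complex.exp (-(2 * Real.pi * I * k * t)) * φ (t : UnitAddCircle) := by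
  rw [fourierFunctional_apply, fourierCoeff_eq_intervalIntegral _ _ 0]
  simp only [zero_add, smul_eq_mul, div_one, one_smul]
  congr 1
  ext t
  congr 1
  refine (fourier_coe_apply (T := 1) (n := -k) (x := t)).trans ?_
  congr 1
  push_cast
  ring

open ComplexConjugate in
theorem hasSum_fourierFunctional_mul (φ ψ : C(UnitAddCircle, ℂ)) (l : ℤ) :
    HasSum (fun i : ℤ => fourierFunctional (l - i) φ * fourierFunctional i ψ)
      (fourierFunctional l (φ * ψ)) := by
  have h := (fourierBasis (T := 1)).hasSum_inner_mul_inner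
    (ContinuousMap.toLp 2 AddCircle.haarAddCircle ℂ (star φ * fourier l))
    (ContinuousMap.toLp 2 AddCircle.haarAddCircle ℂ ψ)
  rw [coe_fourierBasis] at h
  simp only [fourierLp, ContinuousMap.inner_toLp] at h
  have e1 : ∀ x : UnitAddCircle, ψ x * conj ((star φ * fourier l : C(UnitAddCircle, ℂ)) x) =
      fourier (-l) x * (φ * ψ) x := fun x => by
    simp only [ContinuousMap.mul_apply, ContinuousMap.star_apply, map_mul, fourier_neg,
      RCLike.star_def, Complex.conj_conj]
    ring
  have e2 : ∀ (i : ℤ) (x : UnitAddCircle), fourier i x * conj ((star φ * fourier l : C(UnitAddCircle, ℂ)) x) =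
      fourier (-(l - i)) x * φ x := fun i x => by
    rw [neg_sub, sub_eq_add_neg, fourier_add]
    simp only [ContinuousMap.mul_apply, ContinuousMap.star_apply, map_mul, fourier_neg,
      RCLike.star_def, Complex.conj_conj]
    ring
  have e3 : ∀ (i : ℤ) (x : UnitAddCircle), ψ x * conj (fourier i x) =
      fourier (-i) x * ψ x := fun i x => by
    rw [fourier_neg, mul_comm]
  simp only [e1, e2, e3] at h
  exact h

theorem fourierFunctional_mul_eq_zero {φ ψ : C(UnitAddCircle, ℂ)} {a b : ℤ}
    (hφ : ∀ l > a, fourierFunctional l φ = 0) (hψ : ∀ l > b, fourierFunctional l ψ = 0)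
    {l : ℤ} (hl : a + b < l) : fourierFunctional l (φ * ψ) = 0 := by
  rw [← (hasSum_fourierFunctional_mul φ ψ l).tsum_eq]
  refine (tsum_congr fun i => ?_).trans tsum_zero
  rcases lt_or_ge b i with h | h
  · rw [hψ i h, mul_zero]
  · rw [hφ _ (by omega), zero_mul]

theorem fourierFunctional_mul_top {φ ψ : C(UnitAddCircle, ℂ)} {a b : ℤ}
    (hφ : ∀ l > a, fourierFunctional l φ = 0) (hψ : ∀ l > b, fourierFunctional l ψ = 0) :
    fourierFunctional (a + b) (φ * ψ) = fourierFunctional a φ * fourierFunctional b ψ := by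
  rw [← (hasSum_fourierFunctional_mul φ ψ (a + b)).tsum_eq, tsum_eq_single b, add_sub_cancel_right]
  intro i hi
  rcases lt_or_gt_of_ne hi with h | h
  · rw [hφ _ (by omega), zero_mul]
  · rw [hψ i h, mul_zero]

theorem eq_zero_of_fourierFunctional_eq_zero {φ : C(UnitAddCircle, ℂ)}
    (h : ∀ k, fourierFunctional k φ = 0) : φ = 0 := by
  have h0 : ∀ k : ℤ, fourierCoeff φ k = 0 := h
  have h1 : Summable (fourierCoeff φ) := by
    rw [funext h0]
    exact summable_zero
  have h2 := hasSum_fourier_series_of_summable (T := 1) (f := φ) h1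
  have h3 : (fun n : ℤ => fourierCoeff φ n • (fourier n : C(UnitAddCircle, ℂ))) = fun _ => 0 := by
    funext n
    rw [h0]
    ext x
    exact zero_mul (fourier n x)
  rw [h3] at h2
  exact h2.unique hasSum_zero

/-- Formal Taylor coefficients of the compositions `F^{(j)} ∘ (id + ∑ Gₙ εⁿ)`: the coefficient
of `εⁿ`, where `F j` stands for the `j`-th derivative at the base point. -/
def compCoeff {A : Type*} [Ring A] [Algebra ℂ A] (F G : ℕ → A) : ℕ → ℕ → A
  | 0, j => F j
  | n + 1, j => ((n + 1 : ℂ)⁻¹) •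
      ∑ i : Fin (n + 1), ((i : ℂ) + 1) • (G (i + 1) * compCoeff F G (n - i) (j + 1))
  termination_by n => n
  decreasing_by omega

theorem compCoeff_zero {A : Type*} [Ring A] [Algebra ℂ A] (F G : ℕ → A) (j : ℕ) :
    compCoeff F G 0 j = F j := by
  rw [compCoeff]

theorem compCoeff_succ {A : Type*} [Ring A] [Algebra ℂ A] (F G : ℕ → A) (n j : ℕ) :
    compCoeff F G (n + 1) j = ((n + 1 : ℂ)⁻¹) •
      ∑ i ∈ Finset.range (n + 1), ((i : ℂ) + 1) • (G (i + 1) * compCoeff F G (n - i) (j + 1)) := by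
  rw [compCoeff, Finset.sum_range fun i : ℕ =>
    ((i : ℂ) + 1) • (G (i + 1) * compCoeff F G (n - i) (j + 1))]

theorem map_compCoeff {A A' : Type*} [Ring A] [Algebra ℂ A] [Ring A'] [Algebra ℂ A']
    (f : A →ₐ[ℂ] A') (F G : ℕ → A) (n j : ℕ) :
    f (compCoeff F G n j) = compCoeff (f ∘ F) (f ∘ G) n j := by
  induction n using Nat.strong_induction_on generalizing j with
  | _ n ih =>
    cases n with
    | zero => simp [compCoeff_zero]
    | succ n =>
      simp only [compCoeff_succ, _root_.map_smul, map_sum, map_mul]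
      congr 1
      refine Finset.sum_congr rfl fun i hi => ?_
      rw [ih (n - i) (by omega)]
      rfl

theorem differentiableOn_compCoeff {F : ℕ → C(UnitAddCircle, ℂ)}
    {G : ℂ → ℕ → C(UnitAddCircle, ℂ)} {K : Set ℂ}
    (hG : ∀ n, DifferentiableOn ℂ (fun q => G q n) K) (n j : ℕ) :
    DifferentiableOn ℂ (fun q => compCoeff F (G q) n j) K := by
  induction n using Nat.strong_induction_on generalizing j with
  | _ n ih =>
    cases n with
    | zero => simp [compCoeff_zero]
    | succ n =>
      simp only [compCoeff_succ]
      refine DifferentiableOn.fun_const_smul (DifferentiableOn.fun_sum fun i _ => ?_) _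
      exact ((hG (i + 1)).mul (ih (n - i) (by omega) (j + 1))).fun_const_smul _

theorem eq_neg_mul_sq_of_norm_eq_one {w : ℂ} (hw : ‖w‖ = 1) (h1 : w ≠ 1) :
    ∃ s : ℝ, 1 / 4 ≤ s ∧ w = -(s : ℂ) * (w - 1) ^ 2 := by
  have h0 : w ≠ 0 := by
    rintro rfl
    simp at hw
  have h2 : 0 < ‖w - 1‖ := norm_pos_iff.2 (sub_ne_zero.2 h1)
  have h3 : ‖w - 1‖ ≤ 2 := by
    have := norm_sub_le w 1
    rw [hw, norm_one] at this
    linarith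
  refine ⟨1 / ‖w - 1‖ ^ 2, one_div_le_one_div_of_le (by positivity) (by nlinarith), ?_⟩
  have h4 : ((‖w - 1‖ ^ 2 : ℝ) : ℂ) = (w - 1) * (w⁻¹ - 1) := by
    rw [Complex.inv_eq_conj hw]
    have := Complex.mul_conj' (w - 1)
    rw [map_sub, map_one] at this
    rw [this]
    push_cast
    rfl
  have h5 : w - 1 ≠ 0 := sub_ne_zero.2 h1
  have h6 : w⁻¹ - 1 ≠ 0 := by
    rw [sub_ne_zero]
    simpa using h1
  rw [Complex.ofReal_div, Complex.ofReal_one, h4]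
  have h7 : w⁻¹ - 1 = -(w - 1) / w := by
    field_simp
    ring
  rw [h7]
  field_simp

theorem fourierFunctional_compCoeff_top {F G : ℕ → C(UnitAddCircle, ℂ)} {N : ℕ} (hN : 0 < N)
    (hF : ∀ (j : ℕ) (k : ℤ),
      fourierFunctional k (F j) = (2 * Real.pi * I * k) ^ j * fourierFunctional k (F 0))
    (hFN : ∀ k : ℤ, (N : ℤ) < k → fourierFunctional k (F 0) = 0)
    {q : ℂ} (hq : ‖q‖ = 1) (hq1 : ∀ l : ℕ, 0 < l → q ^ l ≠ 1)
    (hG : ∀ n l : ℕ, 0 < l → (q ^ l - 1) ^ 2 * fourierFunctional l (G (n + 1)) =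
      q ^ l * fourierFunctional l (compCoeff F G n 0)) (n : ℕ) :
    ∃ b : ℝ, ((4 : ℝ) ^ n * n.factorial)⁻¹ ≤ b ∧ ∀ j,
      (∀ l : ℤ, ((n + 1 : ℕ) * N : ℤ) < l → fourierFunctional l (compCoeff F G n j) = 0) ∧
      fourierFunctional ((n + 1 : ℕ) * N : ℤ) (compCoeff F G n j) =
        (2 * Real.pi * I * N) ^ j * fourierFunctional N (F 0) *
          (-(2 * Real.pi * I * N) * fourierFunctional N (F 0)) ^ n * b := by
  set κ : ℂ := 2 * Real.pi * I * N with hκ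
  set f : ℂ := fourierFunctional N (F 0) with hf
  have hκ0 : κ ≠ 0 := mul_ne_zero Complex.two_pi_I_ne_zero (by exact_mod_cast hN.ne')
  induction n using Nat.strong_induction_on with
  | _ n ih =>
  have hGl : ∀ m, ∀ l : ℕ, 0 < l → ∃ s : ℝ, 1 / 4 ≤ s ∧
      fourierFunctional l (G (m + 1)) = -(s : ℂ) * fourierFunctional l (compCoeff F G m 0) := by
    intro m l hl
    obtain ⟨s, hs, h⟩ := eq_neg_mul_sq_of_norm_eq_one (w := q ^ l) (by simp [hq]) (hq1 l hl)
    refine ⟨s, hs, mul_left_cancel₀ (pow_ne_zero 2 (sub_ne_zero.2 (hq1 l hl))) ?_⟩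
    rw [hG m l hl]
    nth_rewrite 1 [h]
    ring
  have hGs : ∀ m < n, ∃ b c : ℝ, ((4 : ℝ) ^ m * m.factorial)⁻¹ ≤ b ∧ b / 4 ≤ c ∧
      (∀ l : ℤ, ((m + 1 : ℕ) * N : ℤ) < l → fourierFunctional l (G (m + 1)) = 0) ∧
      κ * fourierFunctional ((m + 1 : ℕ) * N : ℤ) (G (m + 1)) = (-κ * f) ^ (m + 1) * c ∧
      ∀ j, (∀ l : ℤ, ((m + 1 : ℕ) * N : ℤ) < l → fourierFunctional l (compCoeff F G m j) = 0) ∧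
      fourierFunctional ((m + 1 : ℕ) * N : ℤ) (compCoeff F G m j) =
        κ ^ j * f * (-κ * f) ^ m * b := by
    intro m hm
    obtain ⟨b, hb, h⟩ := ih m hm
    obtain ⟨s, hs, hs'⟩ := hGl m ((m + 1) * N) (by positivity)
    have hb0 : 0 ≤ b := le_trans (by positivity) hb
    refine ⟨b, s * b, hb, by nlinarith, fun l hl => ?_, ?_, h⟩
    · have hl0 : 0 < l := lt_of_le_of_lt (by positivity) hl
      lift l to ℕ using hl0.le
      obtain ⟨s, -, h'⟩ := hGl m l (by exact_mod_cast hl0)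
      rw [h', (h 0).1 l hl, mul_zero]
    · have h2 := (h 0).2
      push_cast at hs' h2 ⊢
      rw [hs', h2]
      ring
  cases n with
  | zero =>
    refine ⟨1, by simp, fun j => ⟨fun l hl => ?_, ?_⟩⟩
    · rw [compCoeff_zero, hF, hFN l (by simpa using hl), mul_zero]
    · simp [compCoeff_zero, hF j, hκ, hf]
  | succ n =>
    choose! b c hb hc hGz hGt hH using hGs
    have hb0 : ∀ m < n + 1, 0 ≤ b m := fun m hm => le_trans (by positivity) (hb m hm)
    have hc0 : ∀ m < n + 1, 0 ≤ c m := fun m hm => by linarith [hc m hm, hb0 m hm]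
    refine ⟨(n + 1 : ℝ)⁻¹ * ∑ i ∈ Finset.range (n + 1), ((i : ℝ) + 1) * (c i * b (n - i)), ?_,
      fun j => ⟨fun l hl => ?_, ?_⟩⟩
    · have h1 : ((0 : ℕ) + 1 : ℝ) * (c 0 * b (n - 0)) ≤
          ∑ i ∈ Finset.range (n + 1), ((i : ℝ) + 1) * (c i * b (n - i)) :=
        Finset.single_le_sum (f := fun i : ℕ => ((i : ℝ) + 1) * (c i * b (n - i)))
          (fun i hi => mul_nonneg (by positivity) (mul_nonneg
            (hc0 i (Finset.mem_range.1 hi)) (hb0 _ (by omega)))) (by simp)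
      have h2 := hb 0 (by omega)
      have h3 := hc 0 (by omega)
      have h4 := hb n (by omega)
      have h6 := hb0 n (by omega)
      have h5 : ((4 : ℝ) ^ (n + 1) * (n + 1).factorial)⁻¹ =
          (n + 1 : ℝ)⁻¹ * (4⁻¹ * ((4 : ℝ) ^ n * n.factorial)⁻¹) := by
        rw [Nat.factorial_succ]
        push_cast
        field_simp
        ring
      rw [h5]
      refine mul_le_mul_of_nonneg_left (le_trans ?_ h1) (by positivity)
      simp only [pow_zero, Nat.factorial_zero, Nat.cast_one, mul_one, inv_one, Nat.cast_zero,
        zero_add, one_mul, Nat.sub_zero] at h1 h2 ⊢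
      nlinarith
    · rw [compCoeff_succ, _root_.map_smul, map_sum, Finset.sum_eq_zero, smul_zero]
      intro i hi
      rw [Finset.mem_range] at hi
      rw [_root_.map_smul, fourierFunctional_mul_eq_zero (hGz i hi) (hH (n - i) (by omega) (j + 1)).1,
        smul_zero]
      refine lt_of_eq_of_lt ?_ hl
      push_cast [Nat.cast_sub (Nat.lt_succ_iff.1 hi)]
      ring
    · rw [compCoeff_succ, _root_.map_smul, map_sum]
      push_cast
      simp only [smul_eq_mul, Finset.mul_sum]
      refine Finset.sum_congr rfl fun i hi => ?_
      rw [Finset.mem_range] at hi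
      have h1 := fourierFunctional_mul_top (hGz i hi) (hH (n - i) (by omega) (j + 1)).1
      have h2 := hGt i hi
      have h3 := (hH (n - i) (by omega) (j + 1)).2
      have h4 : (((i + 1 : ℕ) * N : ℤ) + ((n - i + 1 : ℕ) * N : ℤ)) = ((n : ℤ) + 1 + 1) * N := by
        push_cast [Nat.cast_sub (Nat.lt_succ_iff.1 hi)]
        ring
      rw [h4, h3] at h1
      have h5 : (-κ * f) ^ (n + 1) = (-κ * f) ^ (i + 1) * (-κ * f) ^ (n - i) := by
        rw [← pow_add]
        congr 1
        omega
      rw [_root_.map_smul, smul_eq_mul, h1, h5, pow_succ κ j]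
      linear_combination ((n : ℂ) + 1)⁻¹ * ((i : ℂ) + 1) * κ ^ j * f * (-κ * f) ^ (n - i) *
        (b (n - i)) * h2

theorem norm_Efn_ofReal (ω : ℝ) : ‖Efn ω‖ = 1 := by
  rw [Efn, Complex.norm_exp]
  simp

theorem continuous_Efn : Continuous Efn := by
  unfold Efn
  fun_prop

theorem exists_Efn_ofReal {q : ℂ} (hq : ‖q‖ = 1) : ∃ ω : ℝ, Efn ω = q := by
  refine ⟨q.arg / (2 * Real.pi), ?_⟩
  have h := Complex.norm_mul_exp_arg_mul_I q
  rw [hq, Complex.ofReal_one, one_mul] at h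
  rw [Efn, ← h]
  congr 1
  have : (Real.pi : ℂ) ≠ 0 := by exact_mod_cast Real.pi_ne_zero
  rw [h]
  push_cast
  field_simp

theorem Efn_div_pow_eq_one (n : ℤ) {k : ℕ} (hk : 0 < k) : Efn ((n / k : ℝ) : ℂ) ^ k = 1 := by
  have h : (k : ℂ) ≠ 0 := by exact_mod_cast hk.ne'
  rw [Efn_pow, Complex.exp_eq_one_iff]
  refine ⟨n, ?_⟩
  push_cast
  field_simp

theorem Efn_pow_ne_one_of_irrational {ω : ℝ} (hω : Irrational ω) {k : ℕ} (hk : 0 < k) :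
    Efn ω ^ k ≠ 1 := by
  rw [Efn_pow, Ne, Complex.exp_eq_one_iff]
  rintro ⟨n, hn⟩
  have h1 : ((k : ℂ) * ω) = n := by
    apply mul_left_cancel₀ Complex.two_pi_I_ne_zero
    rw [hn]
    ring
  have h2 : (k : ℝ) * ω = n := by exact_mod_cast h1
  have hk' : (k : ℝ) ≠ 0 := by exact_mod_cast hk.ne'
  refine hω ⟨(n : ℚ) / k, ?_⟩
  push_cast
  rw [← h2]
  field_simp

theorem exists_fourierFunctional_ne_zero {φ : C(UnitAddCircle, ℂ)} (hne : φ ≠ 0)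
    (h0 : fourierFunctional 0 φ = 0)
    (hreal : ∀ k : ℤ, fourierFunctional (-k) φ = starRingEnd ℂ (fourierFunctional k φ)) :
    ∃ k : ℕ, 0 < k ∧ fourierFunctional k φ ≠ 0 := by
  by_contra! h
  refine hne (eq_zero_of_fourierFunctional_eq_zero fun k => ?_)
  rcases lt_trichotomy k 0 with hk | rfl | hk
  · rw [← neg_neg k, hreal]
    have h1 : 0 < -k := by omega
    lift -k to ℕ using h1.le with m
    rw [h m (by exact_mod_cast h1), map_zero]
  · exact h0
  · lift k to ℕ using hk.le
    exact h k (by exact_mod_cast hk)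

theorem false_of_recursion_of_mem_circle {F : ℕ → C(UnitAddCircle, ℂ)}
    (hF : ∀ (j : ℕ) (k : ℤ),
      fourierFunctional k (F j) = (2 * Real.pi * I * k) ^ j * fourierFunctional k (F 0))
    (hne : F 0 ≠ 0) (h0 : fourierFunctional 0 (F 0) = 0)
    (hreal : ∀ k : ℤ, fourierFunctional (-k) (F 0) = starRingEnd ℂ (fourierFunctional k (F 0)))
    {U : Set ℂ} (hU : IsOpen U) {qs : ℂ} (hqs : ‖qs‖ = 1) (hqU : qs ∈ U)
    {G : ℂ → ℕ → C(UnitAddCircle, ℂ)} (hGc : ∀ n, ContinuousOn (fun q => G q n) U)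
    (hG : ∀ q ∈ U, ∀ n l : ℕ, 0 < l → (q ^ l - 1) ^ 2 * fourierFunctional l (G q (n + 1)) =
      q ^ l * fourierFunctional l (compCoeff F (G q) n 0)) : False := by
  obtain ⟨x, rfl⟩ := exists_Efn_ofReal hqs
  have hV : IsOpen ((fun ω : ℝ => Efn (ω : ℂ)) ⁻¹' U) :=
    hU.preimage (continuous_Efn.comp Complex.continuous_ofReal)
  obtain ⟨δ, hδ, hδU⟩ := Metric.isOpen_iff.1 hV x hqU
  have hroot : ∀ k : ℕ, 1 / δ < k → ∃ q ∈ U, q ^ k = 1 := by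
    intro k hk
    have hk0 : (0 : ℝ) < k := lt_trans (by positivity) hk
    refine ⟨_, hδU (a := (⌊x * k⌋ / k : ℝ)) ?_, Efn_div_pow_eq_one _ (by exact_mod_cast hk0)⟩
    rw [mem_ball, Real.dist_eq, abs_sub_comm]
    have h1 := Int.floor_le (x * k)
    have h2 := Int.lt_floor_add_one (x * k)
    have h3 : x - ⌊x * k⌋ / k = (x * k - ⌊x * k⌋) / k := by field_simp
    rw [h3, abs_of_nonneg (div_nonneg (by linarith) hk0.le), div_lt_iff₀ hk0]
    rw [div_lt_iff₀ hδ] at hk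
    linarith
  obtain ⟨K, hK⟩ := exists_nat_gt (1 / δ)
  by_cases hinf : ∀ n : ℕ, ∃ k : ℕ, n < k ∧ fourierFunctional k (F 0) ≠ 0
  · obtain ⟨k, hk, hfk⟩ := hinf K
    obtain ⟨q, hqU, hq⟩ := hroot k (hK.trans (by exact_mod_cast hk))
    have := hG q hqU 0 k (by omega)
    rw [hq, compCoeff_zero] at this
    simp at this
    exact hfk this.symm
  push Not at hinf
  obtain ⟨N, hN0, hfN, hFN⟩ : ∃ N : ℕ, 0 < N ∧ fourierFunctional N (F 0) ≠ 0 ∧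
      ∀ k : ℤ, (N : ℤ) < k → fourierFunctional k (F 0) = 0 := by
    classical
    obtain ⟨n, hn⟩ := hinf
    obtain ⟨k, hk, hfk⟩ := exists_fourierFunctional_ne_zero hne h0 hreal
    have hkn : k ≤ n := not_lt.1 fun h => hfk (hn k h)
    have hs := Nat.findGreatest_spec (P := fun k : ℕ => fourierFunctional k (F 0) ≠ 0) hkn hfk
    refine ⟨_, lt_of_lt_of_le hk (Nat.le_findGreatest hkn hfk), hs, fun l hl => ?_⟩
    have hl0 : 0 < l := lt_of_le_of_lt (by positivity) hl
    lift l to ℕ using hl0.le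
    by_contra hfl
    have hln : l ≤ n := not_lt.1 fun h => hfl (hn l h)
    exact Nat.findGreatest_is_greatest (by exact_mod_cast hl) hln hfl
  obtain ⟨q₀, hq₀, hq₀1⟩ := hroot (K + 1) (hK.trans (by push_cast; linarith))
  have hq₀n : ‖q₀‖ = 1 := norm_eq_one_of_pow_eq_one hq₀1 (by omega)
  obtain ⟨y, rfl⟩ := exists_Efn_ofReal hq₀n
  set κ : ℂ := 2 * Real.pi * I * N with hκ
  set f : ℂ := fourierFunctional N (F 0) with hf
  have hκ0 : κ ≠ 0 := mul_ne_zero Complex.two_pi_I_ne_zero (by exact_mod_cast hN0.ne')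
  set c : ℝ := ‖f‖ * ‖-κ * f‖ ^ K * ((4 : ℝ) ^ K * K.factorial)⁻¹ with hc
  have hc0 : 0 < c := by
    have : 0 < ‖f‖ := norm_pos_iff.2 hfN
    have : 0 < ‖-κ * f‖ := norm_pos_iff.2 (mul_ne_zero (neg_ne_zero.2 hκ0) hfN)
    positivity
  let Φ : ℝ → ℝ := fun ω => ‖(Efn (ω : ℂ) ^ ((K + 1) * N) - 1) ^ 2 *
    fourierFunctional ((K + 1) * N : ℕ) (G (Efn (ω : ℂ)) (K + 1))‖
  have hΦ : ∀ ω : ℝ, Irrational ω → Efn (ω : ℂ) ∈ U → c ≤ Φ ω := by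
    intro ω hω hωU
    obtain ⟨b, hb, h⟩ := fourierFunctional_compCoeff_top hN0 hF hFN (norm_Efn_ofReal ω)
      (fun l hl => Efn_pow_ne_one_of_irrational hω hl) (hG _ hωU) K
    have h2 := (h 0).2
    simp only [Φ]
    rw [hG _ hωU K _ (by positivity), Nat.cast_mul, h2]
    simp only [norm_mul, norm_pow, norm_Efn_ofReal, one_pow, one_mul, pow_zero, Complex.norm_real,
      Real.norm_eq_abs]
    rw [hc, abs_of_nonneg (le_trans (by positivity) hb)]
    simp only [norm_mul]
    gcongr
  have hcont : ContinuousAt Φ y := by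
    have h1 : ContinuousAt (fun ω : ℝ => Efn (ω : ℂ)) y :=
      (continuous_Efn.comp Complex.continuous_ofReal).continuousAt
    have h2 : ContinuousAt (fun ω : ℝ => G (Efn (ω : ℂ)) (K + 1)) y :=
      ((hGc (K + 1)).continuousAt (hU.mem_nhds hq₀)).comp
        (f := fun ω : ℝ => Efn (ω : ℂ)) (x := y) h1
    have h3 := (fourierFunctional ((K + 1) * N : ℕ)).continuous.continuousAt.comp h2
    exact ((((h1.pow _).sub continuousAt_const).pow 2).mul h3).norm
  have hy : Φ y = 0 := by
    simp only [Φ]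
    rw [pow_mul, hq₀1]
    simp
  have hev : ∀ᶠ ω in 𝓝 y, Efn ((ω : ℝ) : ℂ) ∈ U ∧ Φ ω < c := by
    refine ((continuous_Efn.comp Complex.continuous_ofReal).continuousAt.eventually
      (hU.mem_nhds hq₀)).and (hcont.eventually (gt_mem_nhds ?_))
    rw [hy]
    exact hc0
  obtain ⟨ω, ⟨h1, h2⟩, hω⟩ := mem_closure_iff_nhds.1 (dense_irrational y) _ hev
  exact absurd (hΦ ω hω h1) (not_le.2 h2)

/-- The continuous function on the circle induced by a continuous 1-periodic function. -/
def circleLift (f : ℝ → ℂ) (hf : Continuous f) (hp : Function.Periodic f 1) :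
    C(UnitAddCircle, ℂ) where
  toFun := hp.lift
  continuous_toFun := continuous_coinduced_dom.2 hf

theorem circleLift_coe (f : ℝ → ℂ) (hf : Continuous f) (hp : Function.Periodic f 1) (x : ℝ) :
    circleLift f hf hp (x : UnitAddCircle) = f x := rfl

/-- The `n`-th Taylor coefficient at `0`. -/
def taylorCoeff (n : ℕ) (f : ℂ → ℂ) : ℂ := iteratedDeriv n f 0 / n.factorial

theorem taylorCoeff_eq_circleIntegral {ρ : ℝ} (hρ : 0 < ρ) {f : ℂ → ℂ}
    (hf : DifferentiableOn ℂ f (ball 0 ρ)) (n : ℕ) :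
    taylorCoeff n f = (2 * Real.pi * I)⁻¹ • ∮ z in C(0, ρ / 2), (1 / (z - 0) ^ (n + 1)) • f z := by
  have h := (hf.mono (closedBall_subset_ball (half_lt_self hρ))
    ).circleIntegral_one_div_sub_center_pow_smul (half_pos hρ) n
  rw [h, taylorCoeff, smul_smul, div_eq_mul_inv (2 * Real.pi * I : ℂ), ← mul_assoc,
    inv_mul_cancel₀ Complex.two_pi_I_ne_zero, one_mul, smul_eq_mul]
  ring

theorem norm_taylorCoeff_le {ρ : ℝ} (hρ : 0 < ρ) {f : ℂ → ℂ}
    (hf : DifferentiableOn ℂ f (ball 0 ρ)) {C : ℝ} (hC : ∀ z ∈ ball (0 : ℂ) ρ, ‖f z‖ ≤ C) (n : ℕ) :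
    ‖taylorCoeff n f‖ ≤ (2 / ρ) ^ n * C := by
  rw [taylorCoeff_eq_circleIntegral hρ hf]
  have h : (2 / ρ) ^ n * C = ρ / 2 * ((2 / ρ) ^ (n + 1) * C) := by
    rw [pow_succ]
    field_simp
  rw [h]
  refine circleIntegral.norm_two_pi_i_inv_smul_integral_le_of_norm_le_const (half_pos hρ).le
    fun z hz => ?_
  have hz' : ‖z‖ = ρ / 2 := by simpa using hz
  rw [sub_zero, norm_smul, norm_div, norm_one, norm_pow, hz', one_div, ← inv_pow, inv_div]
  gcongr
  exact hC z (by rw [mem_ball_zero_iff, hz']; linarith)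

theorem ofReal_mem_Strip {R : ℝ} (hR : 0 < R) (θ : ℝ) : (θ : ℂ) ∈ Strip R := by
  show |(θ : ℂ).im| < R
  simpa using hR

theorem isOpen_Strip (R : ℝ) : IsOpen (Strip R) :=
  isOpen_lt (by fun_prop) continuous_const

theorem ValHol.differentiableOn_snd {R ρ : ℝ} {w : ℂ × ℂ → ℂ} (hw : ValHol R ρ w)
    {θ : ℂ} (hθ : θ ∈ Strip R) : DifferentiableOn ℂ (fun ε => w (θ, ε)) (ball 0 ρ) :=
  hw.2.comp (by fun_prop) fun _ hε => ⟨hθ, hε⟩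

theorem ValHol.continuous_taylorCoeff {R ρ : ℝ} (hR : 0 < R) (hρ : 0 < ρ) {w : ℂ × ℂ → ℂ}
    (hw : ValHol R ρ w) (n : ℕ) :
    Continuous fun θ : ℝ => taylorCoeff n fun ε => w ((θ : ℂ), ε) := by
  simp only [fun θ : ℝ => taylorCoeff_eq_circleIntegral hρ
    (hw.differentiableOn_snd (ofReal_mem_Strip hR θ)) n, circleIntegral]
  refine Continuous.fun_const_smul (M := ℂ) (α := ℂ) ?_ _
  refine intervalIntegral.continuous_parametric_intervalIntegral_of_continuous' ?_ _ _
  have h1 : Continuous fun p : ℝ × ℝ => w ((p.1 : ℂ), circleMap 0 (ρ / 2) p.2) := by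
    refine hw.2.continuousOn.comp_continuous (by fun_prop) fun p => ⟨ofReal_mem_Strip hR _, ?_⟩
    rw [mem_ball_zero_iff, norm_circleMap_zero, abs_of_pos (half_pos hρ)]
    linarith
  have h2 : ∀ p : ℝ × ℝ, (circleMap 0 (ρ / 2) p.2 - 0) ^ (n + 1) ≠ 0 := fun p => by
    rw [sub_zero]
    exact pow_ne_zero _ (circleMap_ne_center (half_pos hρ).ne')
  simp only [deriv_circleMap, Function.uncurry_def]
  have h3 : Continuous fun p : ℝ × ℝ => circleMap 0 (ρ / 2) p.2 := by fun_prop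
  exact (h3.mul continuous_const).smul
    ((continuous_const.div ((h3.sub continuous_const).pow _) h2).smul h1)

theorem ValHol.periodic_taylorCoeff {R ρ : ℝ} {w : ℂ × ℂ → ℂ} (hw : ValHol R ρ w) (n : ℕ) :
    Function.Periodic (fun θ : ℝ => taylorCoeff n fun ε => w ((θ : ℂ), ε)) 1 := fun θ => by
  simp only [Complex.ofReal_add, Complex.ofReal_one, hw.1]

/-- The elements of `B_{R,ρ}`, without the boundedness condition, as a submodule. -/
def valHolSubmodule (R ρ : ℝ) : Submodule ℂ (ℂ × ℂ → ℂ) where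
  carrier := {w | ValHol R ρ w}
  add_mem' := fun {v w} hv hw => ⟨fun θ ε => by simp [hv.1, hw.1], hv.2.add hw.2⟩
  zero_mem' := ⟨fun _ _ => rfl, differentiableOn_const _⟩
  smul_mem' := fun c w hw => ⟨fun θ ε => by simp [hw.1], hw.2.const_smul c⟩

/-- The `n`-th Taylor coefficient in `ε`, as a function on the circle. -/
def taylorMap {R ρ : ℝ} (hR : 0 < R) (hρ : 0 < ρ) (n : ℕ) :
    valHolSubmodule R ρ →ₗ[ℂ] C(UnitAddCircle, ℂ) where
  toFun w := circleLift (fun θ => taylorCoeff n fun ε => w.1 ((θ : ℂ), ε))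
    (ValHol.continuous_taylorCoeff hR hρ w.2 n) (ValHol.periodic_taylorCoeff w.2 n)
  map_add' v w := by
    ext x
    obtain ⟨θ, rfl⟩ := QuotientAddGroup.mk_surjective x
    have h : ∀ v : valHolSubmodule R ρ, ContDiffAt ℂ n (fun ε => v.1 ((θ : ℂ), ε)) 0 := fun v =>
      ((ValHol.differentiableOn_snd v.2 (ofReal_mem_Strip hR θ)).analyticAt
        (ball_mem_nhds _ hρ)).contDiffAt
    change taylorCoeff n (fun ε => v.1 ((θ : ℂ), ε) + w.1 ((θ : ℂ), ε)) =
      taylorCoeff n _ + taylorCoeff n _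
    simp only [taylorCoeff]
    rw [iteratedDeriv_fun_add (h v) (h w), add_div]
  map_smul' c w := by
    ext x
    obtain ⟨θ, rfl⟩ := QuotientAddGroup.mk_surjective x
    have h : ContDiffAt ℂ n (fun ε => w.1 ((θ : ℂ), ε)) 0 :=
      ((ValHol.differentiableOn_snd w.2 (ofReal_mem_Strip hR θ)).analyticAt
        (ball_mem_nhds _ hρ)).contDiffAt
    change taylorCoeff n (fun ε => c • w.1 ((θ : ℂ), ε)) = c • taylorCoeff n _
    simp only [taylorCoeff]
    rw [iteratedDeriv_fun_const_smul h, smul_div_assoc]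

theorem taylorMap_coe {R ρ : ℝ} (hR : 0 < R) (hρ : 0 < ρ) (n : ℕ) (w : valHolSubmodule R ρ)
    (θ : ℝ) : taylorMap hR hρ n w (θ : UnitAddCircle) =
      taylorCoeff n fun ε => w.1 ((θ : ℂ), ε) := rfl

theorem norm_taylorMap_le {R ρ : ℝ} (hR : 0 < R) (hρ : 0 < ρ) (n : ℕ) (w : valHolSubmodule R ρ)
    {C : ℝ} (hC : ∀ pt ∈ SD R ρ, ‖w.1 pt‖ ≤ C) :
    ‖taylorMap hR hρ n w‖ ≤ (2 / ρ) ^ n * C := by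
  have hC0 : 0 ≤ C := (norm_nonneg _).trans
    (hC (0, 0) ⟨by simpa [Strip] using hR, mem_ball_self hρ⟩)
  rw [ContinuousMap.norm_le _ (by positivity)]
  intro x
  obtain ⟨θ, rfl⟩ := QuotientAddGroup.mk_surjective x
  exact norm_taylorCoeff_le hρ (ValHol.differentiableOn_snd w.2 (ofReal_mem_Strip hR θ))
    (fun z hz => hC _ ⟨ofReal_mem_Strip hR θ, hz⟩) n

/-- Taylor coefficients of a function differentiable for the sup norm are differentiable. The
derivative `v'` need not be known to take values in `valHolSubmodule`. -/
theorem differentiableOn_taylorMap {R ρ : ℝ} (hR : 0 < R) (hρ : 0 < ρ) (n : ℕ) {K : Set ℂ}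
    {v : ℂ → valHolSubmodule R ρ} {v' : ℂ → ℂ × ℂ → ℂ}
    (h : ∀ q ∈ K, ∀ ε > (0 : ℝ), ∃ δ > (0 : ℝ), ∀ q' ∈ K, dist q' q < δ → ∀ pt ∈ SD R ρ,
      ‖(v q').1 pt - (v q).1 pt - (q' - q) * v' q pt‖ ≤ ε * dist q' q) :
    DifferentiableOn ℂ (fun q => taylorMap hR hρ n (v q)) K := by
  intro q hq
  have hC : Cauchy (map (slope (fun q => taylorMap hR hρ n (v q)) q) (𝓝[K \ {q}] q)) ∨
      𝓝[K \ {q}] q = ⊥ := by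
    rcases eq_or_neBot (𝓝[K \ {q}] q) with hb | hb
    · exact Or.inr hb
    left
    rw [Metric.cauchy_iff]
    refine ⟨inferInstance, fun ε hε => ?_⟩
    have hA : 0 < (2 / ρ) ^ n := by positivity
    obtain ⟨δ, hδ, hδ'⟩ := h q hq (ε / (4 * (2 / ρ) ^ n)) (by positivity)
    refine ⟨_, image_mem_map (inter_mem_nhdsWithin _ (ball_mem_nhds q hδ)), ?_⟩
    have key : ∀ q₁ ∈ (K \ {q}) ∩ ball q δ, ∀ pt ∈ SD R ρ,
        ‖(q₁ - q)⁻¹ * ((v q₁).1 pt - (v q).1 pt) - v' q pt‖ ≤ ε / (4 * (2 / ρ) ^ n) := by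
      intro q₁ hq₁ pt hpt
      have h0 : q₁ - q ≠ 0 := sub_ne_zero.2 hq₁.1.2
      have h1 := hδ' q₁ hq₁.1.1 hq₁.2 pt hpt
      have h2 : (q₁ - q)⁻¹ * ((v q₁).1 pt - (v q).1 pt) - v' q pt =
          (q₁ - q)⁻¹ * ((v q₁).1 pt - (v q).1 pt - (q₁ - q) * v' q pt) := by
        field_simp
      rw [h2, norm_mul, norm_inv]
      rw [dist_eq_norm] at h1
      have h3 : 0 < ‖q₁ - q‖ := norm_pos_iff.2 h0
      rw [inv_mul_le_iff₀ h3]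
      linarith
    rintro _ ⟨q₁, hq₁, rfl⟩ _ ⟨q₂, hq₂, rfl⟩
    rw [dist_eq_norm, slope_def_module, slope_def_module, ← map_sub, ← map_sub,
      ← _root_.map_smul, ← _root_.map_smul, ← map_sub]
    refine (norm_taylorMap_le hR hρ n _ (C := 2 * (ε / (4 * (2 / ρ) ^ n))) fun pt hpt => ?_).trans_lt
      ?_
    · have h1 := key q₁ hq₁ pt hpt
      have h2 := key q₂ hq₂ pt hpt
      have h3 := norm_sub_le ((q₁ - q)⁻¹ * ((v q₁).1 pt - (v q).1 pt) - v' q pt)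
        ((q₂ - q)⁻¹ * ((v q₂).1 pt - (v q).1 pt) - v' q pt)
      rw [sub_sub_sub_cancel_right] at h3
      refine le_trans h3 ?_
      linarith
    · field_simp
      linarith
  rcases hC with hC | hC
  · obtain ⟨L, hL⟩ := CompleteSpace.complete hC
    have : HasDerivWithinAt (fun q => taylorMap hR hρ n (v q)) L K q :=
      hasDerivWithinAt_iff_tendsto_slope.2 hL
    exact this.differentiableWithinAt
  · have : HasDerivWithinAt (fun q => taylorMap hR hρ n (v q)) 0 K q := by
      rw [hasDerivWithinAt_iff_tendsto_slope, hC]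
      exact tendsto_bot
    exact this.differentiableWithinAt

theorem integral_fourier_smul_add (φ : C(UnitAddCircle, ℂ)) (a : UnitAddCircle) (k : ℤ) :
    ∫ t, fourier (-k) t • φ (t + a) ∂AddCircle.haarAddCircle =
      fourier k a * fourierFunctional k φ := by
  have h := integral_add_right_eq_self (μ := AddCircle.haarAddCircle)
    (fun t : UnitAddCircle => fourier (-k) (t - a) • φ t) a
  simp only [add_sub_cancel_right] at h
  have h1 : ∀ t, fourier (-k) (t - a) = fourier k a * fourier (-k) t := fun t => by
    rw [fourier_apply, fourier_apply, fourier_apply, ← Circle.coe_mul, ← AddCircle.toCircle_add]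
    congr 2
    rw [smul_sub, neg_smul, neg_smul]
    abel
  rw [h, fourierFunctional_apply, fourierCoeff, ← integral_const_mul]
  congr 1
  ext t
  rw [h1, smul_eq_mul, smul_eq_mul, mul_assoc]

theorem Efn_zpow (ω : ℂ) (k : ℤ) : Efn ω ^ k = Complex.exp (2 * Real.pi * I * (k * ω)) := by
  rw [Efn, ← Complex.exp_int_mul]
  ring_nf

theorem fourier_coe_eq_Efn_zpow (k : ℤ) (ω : ℝ) :
    fourier k (ω : UnitAddCircle) = Efn ω ^ k := by
  rw [Efn_zpow]
  refine (fourier_coe_apply (T := 1)).trans ?_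
  congr 1
  push_cast
  ring

theorem fourierFunctional_of_second_difference {φ ψ : C(UnitAddCircle, ℂ)} {ω : ℝ}
    (h : ∀ θ : ℝ, φ ((θ + ω : ℝ) : UnitAddCircle) - 2 * φ (θ : UnitAddCircle) +
      φ ((θ - ω : ℝ) : UnitAddCircle) = ψ (θ : UnitAddCircle)) (k : ℤ) :
    (Efn ω ^ k - 1) ^ 2 * fourierFunctional k φ = Efn ω ^ k * fourierFunctional k ψ := by
  have hi : ∀ χ : UnitAddCircle → ℂ, Continuous χ →
      Integrable χ AddCircle.haarAddCircle := fun χ hχ =>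
    hχ.integrable_of_hasCompactSupport (HasCompactSupport.of_compactSpace _)
  have hc : ∀ a : UnitAddCircle, Continuous fun t => fourier (-k) t • φ (t + a) := fun a =>
    (fourier (-k)).continuous.smul (φ.continuous.comp (continuous_id.add continuous_const))
  have h1 : fourierFunctional k ψ =
      fourier k (ω : UnitAddCircle) * fourierFunctional k φ -
        2 * (fourier k (0 : UnitAddCircle) * fourierFunctional k φ) +
        fourier k (-ω : UnitAddCircle) * fourierFunctional k φ := by
    have e1 := integral_sub (hi _ (hc ω)) ((hi _ (hc 0)).const_mul 2)
    have e2 := integral_add ((hi _ (hc ω)).sub ((hi _ (hc 0)).const_mul 2)) (hi _ (hc (-ω)))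
    rw [← integral_fourier_smul_add, ← integral_fourier_smul_add, ← integral_fourier_smul_add,
      ← integral_const_mul, ← e1]
    refine Eq.trans ?_ e2
    rw [fourierFunctional_apply, fourierCoeff]
    congr 1
    ext t
    obtain ⟨θ, rfl⟩ := QuotientAddGroup.mk_surjective t
    have := h θ
    simp only [AddCircle.coe_add, AddCircle.coe_sub] at this
    change _ = fourier (-k) (θ : UnitAddCircle) • φ ((θ : UnitAddCircle) + ω) -
      2 * (fourier (-k) (θ : UnitAddCircle) • φ ((θ : UnitAddCircle) + 0)) +
      fourier (-k) (θ : UnitAddCircle) • φ ((θ : UnitAddCircle) + -ω)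
    rw [add_zero, ← sub_eq_add_neg]
    change fourier (-k) (θ : UnitAddCircle) • ψ (θ : UnitAddCircle) = _
    rw [← this]
    simp only [smul_eq_mul]
    ring
  have h2 : fourier k (-ω : UnitAddCircle) = (Efn ω ^ k)⁻¹ := by
    rw [← AddCircle.coe_neg, fourier_coe_eq_Efn_zpow, Efn_zpow, Efn_zpow, ← Complex.exp_neg]
    congr 1
    push_cast
    ring
  have h3 : Efn ω ^ k ≠ 0 := zpow_ne_zero _ (Complex.exp_ne_zero _)
  rw [h1, h2, fourier_eval_zero, fourier_coe_eq_Efn_zpow]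
  field_simp
  ring

theorem differentiableOn_iteratedDeriv {U : Set ℂ} (hU : IsOpen U) {F : ℂ → ℂ}
    (hF : DifferentiableOn ℂ F U) (j : ℕ) : DifferentiableOn ℂ (iteratedDeriv j F) U := by
  induction j with
  | zero => simpa using hF
  | succ j ih =>
    rw [iteratedDeriv_succ]
    exact ih.deriv hU

theorem hasDerivAt_iteratedDeriv {U : Set ℂ} (hU : IsOpen U) {F : ℂ → ℂ}
    (hF : DifferentiableOn ℂ F U) (j : ℕ) {z : ℂ} (hz : z ∈ U) :
    HasDerivAt (iteratedDeriv j F) (iteratedDeriv (j + 1) F z) z := by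
  rw [iteratedDeriv_succ]
  exact ((differentiableOn_iteratedDeriv hU hF j).differentiableAt (hU.mem_nhds hz)).hasDerivAt

theorem iteratedDeriv_periodic {F : ℂ → ℂ} (hF : ∀ z : ℂ, F (z + 1) = F z) (j : ℕ) (z : ℂ) :
    iteratedDeriv j F (z + 1) = iteratedDeriv j F z := by
  have h := congrFun (iteratedDeriv_comp_add_const j F 1) z
  rw [← h]
  congr 1
  exact funext hF

/-- The `j`-th derivative of a periodic function holomorphic in a strip, as a function on the
circle. -/
theorem exists_circle_iteratedDeriv {F : ℂ → ℂ} {R : ℝ} (hR : 0 < R)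
    (hper : ∀ z : ℂ, F (z + 1) = F z) (hF : DifferentiableOn ℂ F (Strip R)) :
    ∃ Φ : ℕ → C(UnitAddCircle, ℂ),
      (∀ (j : ℕ) (θ : ℝ), Φ j (θ : UnitAddCircle) = iteratedDeriv j F θ) ∧
      ∀ (j : ℕ) (k : ℤ), fourierFunctional k (Φ j) =
        (2 * Real.pi * I * k) ^ j * fourierFunctional k (Φ 0) := by
  have hc : ∀ j, Continuous fun θ : ℝ => iteratedDeriv j F θ := fun j =>
    (differentiableOn_iteratedDeriv (isOpen_Strip R) hF j).continuousOn.comp_continuous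
      Complex.continuous_ofReal fun θ => ofReal_mem_Strip hR θ
  have hp : ∀ j, Function.Periodic (fun θ : ℝ => iteratedDeriv j F θ) 1 := fun j θ => by
    simp only [Complex.ofReal_add, Complex.ofReal_one, iteratedDeriv_periodic hper]
  refine ⟨fun j => circleLift _ (hc j) (hp j), fun j θ => rfl, fun j k => ?_⟩
  induction j with
  | zero => simp
  | succ j ih =>
    rw [pow_succ', mul_assoc, ← ih, fourierFunctional_eq_intervalIntegral,
      fourierFunctional_eq_intervalIntegral, ← sub_eq_zero,
      ← intervalIntegral.integral_const_mul]
    simp only [circleLift_coe]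
    have hd : ∀ t : ℝ, HasDerivAt
        (fun t : ℝ => Complex.exp (-(2 * Real.pi * I * k * t)) * iteratedDeriv j F t)
        (Complex.exp (-(2 * Real.pi * I * k * t)) * iteratedDeriv (j + 1) F t -
          2 * Real.pi * I * k *
            (Complex.exp (-(2 * Real.pi * I * k * t)) * iteratedDeriv j F t)) t := fun t => by
      have h1 := (hasDerivAt_iteratedDeriv (isOpen_Strip R) hF j
        (ofReal_mem_Strip hR t)).comp_ofReal
      have h2 : HasDerivAt (fun z : ℂ => Complex.exp (-(2 * Real.pi * I * k * z)))
          (Complex.exp (-(2 * Real.pi * I * k * t)) * (-(2 * Real.pi * I * k))) (t : ℂ) := by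
        have := (((hasDerivAt_id (t : ℂ)).const_mul (2 * Real.pi * I * k : ℂ)).neg).cexp
        simpa using this
      exact (h2.comp_ofReal.mul h1).congr_deriv (by ring)
    have hec : Continuous fun t : ℝ => Complex.exp (-(2 * Real.pi * I * k * t)) := by fun_prop
    have hi : ∀ j, Continuous fun t : ℝ =>
      Complex.exp (-(2 * Real.pi * I * k * t)) * iteratedDeriv j F t := fun j => hec.mul (hc j)
    have hi1 := (hi (j + 1)).intervalIntegrable (μ := volume) 0 1
    have hi2 : IntervalIntegrable (fun t : ℝ => 2 * Real.pi * I * k *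
        (Complex.exp (-(2 * Real.pi * I * k * t)) * iteratedDeriv j F t)) volume 0 1 :=
      Continuous.intervalIntegrable (continuous_const.mul (hi j)) _ _
    rw [← intervalIntegral.integral_sub hi1 hi2,
      intervalIntegral.integral_eq_sub_of_hasDerivAt (fun t _ => hd t) (hi1.sub hi2), sub_eq_zero]
    have e1 : Complex.exp (-(2 * Real.pi * I * k * (1 : ℝ))) = 1 := by
      rw [Complex.exp_eq_one_iff]
      exact ⟨-k, by push_cast; ring⟩
    have e2 := iteratedDeriv_periodic hper j 0
    rw [zero_add] at e2
    rw [e1]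
    simp [e2]

theorem fourierFunctional_neg_of_real {φ : C(UnitAddCircle, ℂ)}
    (h : ∀ θ : ℝ, (φ (θ : UnitAddCircle)).im = 0) (k : ℤ) :
    fourierFunctional (-k) φ = starRingEnd ℂ (fourierFunctional k φ) := by
  rw [fourierFunctional_eq_intervalIntegral, fourierFunctional_eq_intervalIntegral,
    ← intervalIntegral.intervalIntegral_conj]
  congr 1
  ext t
  rw [map_mul, ← Complex.exp_conj, Complex.conj_eq_iff_im.2 (h t)]
  simp [Complex.conj_ofNat]

theorem taylorCoeff_zero (f : ℂ → ℂ) : taylorCoeff 0 f = f 0 := by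
  simp [taylorCoeff]

theorem taylorCoeff_succ (n : ℕ) (f : ℂ → ℂ) :
    taylorCoeff (n + 1) f = (n + 1 : ℂ)⁻¹ * taylorCoeff n (deriv f) := by
  rw [taylorCoeff, taylorCoeff, iteratedDeriv_succ', Nat.factorial_succ]
  push_cast
  rw [mul_comm (n + 1 : ℂ), div_mul_eq_div_div, div_eq_inv_mul _ (n + 1 : ℂ)]

theorem taylorCoeff_congr {f g : ℂ → ℂ} (h : f =ᶠ[𝓝 0] g) (n : ℕ) :
    taylorCoeff n f = taylorCoeff n g := by
  rw [taylorCoeff, taylorCoeff, h.iteratedDeriv_eq]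

theorem taylorCoeff_mul {f g : ℂ → ℂ} (hf : AnalyticAt ℂ f 0) (hg : AnalyticAt ℂ g 0) (n : ℕ) :
    taylorCoeff n (fun ε => f ε * g ε) =
      ∑ i ∈ Finset.range (n + 1), taylorCoeff i f * taylorCoeff (n - i) g := by
  rw [taylorCoeff, iteratedDeriv_fun_mul hf.contDiffAt hg.contDiffAt, Finset.sum_div]
  refine Finset.sum_congr rfl fun i hi => ?_
  have hin : i ≤ n := Nat.lt_succ_iff.1 (Finset.mem_range.1 hi)
  have h0 : ∀ m : ℕ, (m.factorial : ℂ) ≠ 0 := fun m => Nat.cast_ne_zero.2 m.factorial_ne_zero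
  have h : (n.choose i : ℂ) * i.factorial * (n - i).factorial = n.factorial := by
    exact_mod_cast Nat.choose_mul_factorial_mul_factorial hin
  rw [taylorCoeff, taylorCoeff, ← h]
  have h1 : (n.choose i : ℂ) ≠ 0 := Nat.cast_ne_zero.2 (Nat.choose_pos hin).ne'
  have h2 := h0 i
  have h3 := h0 (n - i)
  field_simp

theorem taylorCoeff_succ_id_mul {f : ℂ → ℂ} (hf : AnalyticAt ℂ f 0) (n : ℕ) :
    taylorCoeff (n + 1) (fun ε => ε * f ε) = taylorCoeff n f := by
  rw [taylorCoeff_mul (f := fun ε => ε) analyticAt_id hf, Finset.sum_eq_single 1]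
  · simp [taylorCoeff]
  · intro i _ hi
    simp [taylorCoeff, iteratedDeriv_fun_id_zero, hi]
  · simp

theorem taylorCoeff_iteratedDeriv_add {U : Set ℂ} (hU : IsOpen U) {F : ℂ → ℂ}
    (hF : DifferentiableOn ℂ F U) {a : ℂ → ℂ} (ha : AnalyticAt ℂ a 0) (ha0 : a 0 = 0) {θ : ℂ}
    (hθ : θ ∈ U) (n j : ℕ) :
    taylorCoeff n (fun ε => iteratedDeriv j F (θ + a ε)) =
      compCoeff (fun j => iteratedDeriv j F θ) (fun i => taylorCoeff i a) n j := by
  have hθa : θ + a 0 ∈ U := by rwa [ha0, add_zero]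
  induction n using Nat.strong_induction_on generalizing j with
  | _ n ih =>
    match n with
    | 0 => rw [taylorCoeff_zero, compCoeff_zero, ha0, add_zero]
    | n + 1 =>
      have hd : deriv (fun ε => iteratedDeriv j F (θ + a ε)) =ᶠ[𝓝 0]
          fun ε => deriv a ε * iteratedDeriv (j + 1) F (θ + a ε) := by
        have h1 : ∀ᶠ ε in 𝓝 0, θ + a ε ∈ U :=
          (continuousAt_const.add ha.continuousAt).eventually_mem (hU.mem_nhds hθa)
        filter_upwards [h1, ha.eventually_analyticAt] with ε h1 h2
        have h3 := (hasDerivAt_iteratedDeriv hU hF j h1).comp ε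
          (h2.differentiableAt.hasDerivAt.const_add θ)
        rw [mul_comm]
        exact h3.deriv
      have han : AnalyticAt ℂ (fun ε => iteratedDeriv (j + 1) F (θ + a ε)) 0 := by
        refine AnalyticAt.fun_comp ?_ (analyticAt_const.add ha)
        exact (differentiableOn_iteratedDeriv hU hF (j + 1)).analyticAt (hU.mem_nhds hθa)
      rw [taylorCoeff_succ, taylorCoeff_congr hd, taylorCoeff_mul ha.deriv han, compCoeff_succ,
        smul_eq_mul]
      congr 1
      refine Finset.sum_congr rfl fun i _ => ?_
      rw [ih (n - i) (by omega), taylorCoeff_succ i a, smul_eq_mul, ← mul_assoc, ← mul_assoc,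
        mul_inv_cancel₀ (Nat.cast_add_one_ne_zero i), one_mul]

theorem taylorCoeff_second_difference {f g h : ℂ → ℂ} (hf : AnalyticAt ℂ f 0)
    (hg : AnalyticAt ℂ g 0) (hh : AnalyticAt ℂ h 0) (n : ℕ) :
    taylorCoeff n (fun ε => f ε - 2 * g ε + h ε) =
      taylorCoeff n f - 2 * taylorCoeff n g + taylorCoeff n h := by
  have h1 := iteratedDeriv_fun_add (n := n) (f := fun ε => f ε - 2 * g ε) (g := h)
    (hf.sub (analyticAt_const.mul hg)).contDiffAt hh.contDiffAt
  have h2 := iteratedDeriv_fun_sub (n := n) (f := f) (g := fun ε => 2 * g ε)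
    hf.contDiffAt (analyticAt_const.mul hg).contDiffAt
  have h3 := iteratedDeriv_fun_const_smul (n := n) hg.contDiffAt (2 : ℂ)
  simp only [smul_eq_mul] at h3
  rw [taylorCoeff, h1, h2, h3, taylorCoeff, taylorCoeff, taylorCoeff]
  ring

theorem eventually_eq_of_eq_on_real {f g : ℂ → ℂ} (hf : AnalyticAt ℂ f 0) (hg : AnalyticAt ℂ g 0)
    {ρ : ℝ} (hρ : 0 < ρ) (h : ∀ ε : ℝ, |ε| < ρ → f ε = g ε) : f =ᶠ[𝓝 0] g := by
  refine (hf.frequently_eq_iff_eventually_eq hg).1 ?_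
  have ht : Tendsto ((↑) : ℝ → ℂ) (𝓝[≠] 0) (𝓝[≠] 0) := by
    refine tendsto_nhdsWithin_iff.2 ⟨?_, ?_⟩
    · exact (Complex.continuous_ofReal.tendsto' 0 0 Complex.ofReal_zero).mono_left
        nhdsWithin_le_nhds
    · filter_upwards [self_mem_nhdsWithin] with ε hε
      exact Complex.ofReal_ne_zero.2 hε
  refine ht.frequently (Eventually.frequently ?_)
  filter_upwards [nhdsWithin_le_nhds (ball_mem_nhds (0 : ℝ) hρ)] with ε hε
  exact h ε (by simpa using hε)

theorem Efn_zpow_ne_one {ω : ℂ} (h : ∀ k : ℕ, 0 < k → Efn ω ^ k ≠ 1) {k : ℤ} (hk : k ≠ 0) :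
    Efn ω ^ k ≠ 1 := by
  obtain ⟨m, rfl | rfl⟩ := k.eq_nat_or_neg
  · exact_mod_cast h m (Nat.pos_of_ne_zero (by simpa using hk))
  · rw [zpow_neg, Ne, inv_eq_one]
    exact_mod_cast h m (Nat.pos_of_ne_zero (by simpa using hk))

section Conjugacy

variable {R ρ R' ω : ℝ} {F : ℂ → ℂ} {Φ : ℕ → C(UnitAddCircle, ℂ)}

theorem taylorMap_zero_eq_zero_of_conjugacy (hR : 0 < R) (hρ : 0 < ρ)
    (hω : ∀ k : ℕ, 0 < k → Efn ω ^ k ≠ 1) (w : valHolSubmodule R ρ)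
    (hmean : ∫ t in (0 : ℝ)..1, w.1 ((t : ℂ), 0) = 0)
    (heq : ∀ θ : ℝ, w.1 ((θ : ℂ) + ω, 0) - 2 * w.1 ((θ : ℂ), 0) + w.1 ((θ : ℂ) - ω, 0) = 0) :
    taylorMap hR hρ 0 w = 0 := by
  refine eq_zero_of_fourierFunctional_eq_zero fun k => ?_
  by_cases hk : k = 0
  · subst hk
    rw [fourierFunctional_eq_intervalIntegral]
    simp only [taylorMap_coe, taylorCoeff_zero]
    simpa using hmean
  · have h := fourierFunctional_of_second_difference (φ := taylorMap hR hρ 0 w) (ψ := 0) (ω := ω)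
      (fun θ => by
        simp only [taylorMap_coe, taylorCoeff_zero, Complex.ofReal_add, Complex.ofReal_sub]
        exact heq θ) k
    rw [map_zero, mul_zero] at h
    exact (mul_eq_zero.1 h).resolve_left
      (pow_ne_zero _ (sub_ne_zero.2 (Efn_zpow_ne_one hω hk)))

/-- The order by order form of the equation
`u(θ + ω, ε) - 2 u(θ, ε) + u(θ - ω, ε) = ε F(θ + u(θ, ε))`. -/
theorem recursion_of_conjugacy (hR : 0 < R) (hρ : 0 < ρ) (hR' : 0 < R')
    (hF : DifferentiableOn ℂ F (Strip R'))
    (hΦ : ∀ (j : ℕ) (θ : ℝ), Φ j (θ : UnitAddCircle) = iteratedDeriv j F θ)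
    (hω : ∀ k : ℕ, 0 < k → Efn ω ^ k ≠ 1) (w : valHolSubmodule R ρ)
    (hmean : ∫ t in (0 : ℝ)..1, w.1 ((t : ℂ), 0) = 0)
    (heq : ∀ ε : ℝ, |ε| < ρ → ∀ θ : ℝ, w.1 ((θ : ℂ) + ω, (ε : ℂ)) - 2 * w.1 ((θ : ℂ), (ε : ℂ)) +
      w.1 ((θ : ℂ) - ω, (ε : ℂ)) = ε * F (θ + w.1 ((θ : ℂ), (ε : ℂ)))) (n : ℕ) (k : ℤ) :
    (Efn ω ^ k - 1) ^ 2 * fourierFunctional k (taylorMap hR hρ (n + 1) w) =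
      Efn ω ^ k * fourierFunctional k (compCoeff Φ (fun i => taylorMap hR hρ i w) n 0) := by
  have hw0 : ∀ θ : ℝ, w.1 ((θ : ℂ), 0) = 0 := fun θ => by
    have h := taylorMap_zero_eq_zero_of_conjugacy hR hρ hω w hmean fun θ => by
      simpa using heq 0 (by simpa using hρ) θ
    have := DFunLike.congr_fun h (θ : UnitAddCircle)
    rwa [taylorMap_coe, taylorCoeff_zero] at this
  have han : ∀ θ : ℝ, AnalyticAt ℂ (fun ε => w.1 ((θ : ℂ), ε)) 0 := fun θ =>
    (ValHol.differentiableOn_snd w.2 (ofReal_mem_Strip hR θ)).analyticAt (ball_mem_nhds _ hρ)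
  refine fourierFunctional_of_second_difference (fun θ => ?_) k
  have hθ := ofReal_mem_Strip hR' θ
  have hFan : AnalyticAt ℂ (fun ε => F (θ + w.1 ((θ : ℂ), ε))) 0 := by
    refine AnalyticAt.fun_comp ?_ (analyticAt_const.add (han θ))
    refine hF.analyticAt ((isOpen_Strip R').mem_nhds ?_)
    rwa [hw0, add_zero]
  have h1 := eventually_eq_of_eq_on_real
    (((han (θ + ω)).sub (analyticAt_const.mul (han θ))).add (han (θ - ω)))
    (analyticAt_id.mul hFan) hρ (fun ε hε => by
      simpa using heq ε hε θ)
  have h2 := taylorCoeff_congr h1 (n + 1)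
  have h3 := taylorCoeff_second_difference (han (θ + ω)) (han θ) (han (θ - ω)) (n + 1)
  have h4 := taylorCoeff_succ_id_mul hFan n
  have h5 := taylorCoeff_iteratedDeriv_add (isOpen_Strip R') hF (han θ) (hw0 θ) hθ n 0
  have h6 := map_compCoeff (ContinuousMap.evalAlgHom ℂ ℂ (θ : UnitAddCircle)) Φ
    (fun i => taylorMap hR hρ i w) n 0
  have h7 : (ContinuousMap.evalAlgHom ℂ ℂ (θ : UnitAddCircle)) ∘ Φ =
      fun j => iteratedDeriv j F θ := funext fun j => hΦ j θ
  rw [h7] at h6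
  refine Eq.trans ?_ h6.symm
  refine Eq.trans ?_ h5
  simp only [iteratedDeriv_zero]
  rw [← h4]
  refine Eq.trans ?_ h2
  exact h3.symm

end Conjugacy

/-- The defect in the recursion relation between Fourier-Taylor coefficients. -/
def recursionDefect (Φ : ℕ → C(UnitAddCircle, ℂ)) (G : ℂ → ℕ → C(UnitAddCircle, ℂ)) (n l : ℕ)
    (q : ℂ) : ℂ :=
  (q ^ l - 1) ^ 2 * fourierFunctional l (G q (n + 1)) -
    q ^ l * fourierFunctional l (compCoeff Φ (G q) n 0)

theorem differentiableOn_recursionDefect {Φ : ℕ → C(UnitAddCircle, ℂ)}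
    {G : ℂ → ℕ → C(UnitAddCircle, ℂ)} {K : Set ℂ}
    (hG : ∀ n, DifferentiableOn ℂ (fun q => G q n) K) (n l : ℕ) :
    DifferentiableOn ℂ (recursionDefect Φ G n l) K := by
  have h1 : DifferentiableOn ℂ (fun q : ℂ => fourierFunctional l (G q (n + 1))) K :=
    (fourierFunctional l).differentiable.comp_differentiableOn (hG (n + 1))
  have h2 : DifferentiableOn ℂ (fun q : ℂ => fourierFunctional l (compCoeff Φ (G q) n 0)) K :=
    (fourierFunctional l).differentiable.comp_differentiableOn (differentiableOn_compCoeff hG n 0)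
  have h3 : DifferentiableOn ℂ (fun q : ℂ => q ^ l) K := by fun_prop
  exact (((h3.sub_const 1).pow 2).mul h1).sub (h3.mul h2)

theorem exists_mem_AMR_of_infDist_le {τ M : ℝ} (hA : (AMR τ M).Nonempty) {z : ℂ}
    (hz : infDist z.re (AMR τ M) ≤ z.im) : ∃ a ∈ AMR τ M, |a - z.re| ≤ z.im := by
  obtain ⟨a, ha, h⟩ := (isClosed_AMR τ M).exists_infDist_eq_dist hA z.re
  exact ⟨a, ha, by rwa [abs_sub_comm, ← Real.dist_eq, ← h]⟩

theorem mem_finPart_KM_of_mem_AMC {τ M : ℝ} {ω : ℂ} (h : ω ∈ AMC τ M) :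
    Efn ω ∈ finPart (KM τ M) :=
  Or.inl ⟨ω, h, rfl⟩

theorem exists_mem_AMC_of_mem_finPart_KM {τ M : ℝ} {q : ℂ} (h : q ∈ finPart (KM τ M))
    (h0 : q ≠ 0) : ∃ ω ∈ AMC τ M, Efn ω = q := by
  rcases h with ⟨ω, hω, h⟩ | h | h
  · exact ⟨ω, hω, OnePoint.coe_injective h⟩
  · exact absurd (OnePoint.coe_injective h) h0
  · exact absurd h (OnePoint.coe_ne_infty q)

/-- Quasianalyticity: a function differentiable on `K_M ∩ ℂ` is determined on the complement
of `0` by its values on the Diophantine part of the unit circle. -/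
theorem eq_zero_on_finPart_KM {τ M : ℝ} (hτ : 0 < τ) (hM : 2 * zetaR (1 + τ) < M) {D : ℂ → ℂ}
    (hD : DifferentiableOn ℂ D (finPart (KM τ M)))
    (h0 : ∀ ω ∈ AMR τ M, D (Efn (ω : ℂ)) = 0) {q : ℂ} (hq : q ∈ finPart (KM τ M))
    (hq0 : q ≠ 0) : D q = 0 := by
  have hpos := volume_AMR_pos hτ hM
  have hne : (AMR τ M).Nonempty := nonempty_of_measure_ne_zero hpos.ne'
  have hEd : Differentiable ℂ Efn := by
    unfold Efn
    fun_prop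
  obtain ⟨ω, ⟨ω₀, hω₀, hω⟩, rfl⟩ := exists_mem_AMC_of_mem_finPart_KM hq hq0
  rcases le_total 0 ω.im with him | him
  · refine eq_zero_of_zero_on_pos_measure (isClosed_AMR τ M) hpos (Z := fun z => D (Efn z))
      (hD.comp hEd.differentiableOn fun z hz => ?_) h0 ?_
    · obtain ⟨a, ha, h⟩ := exists_mem_AMR_of_infDist_le hne hz
      exact mem_finPart_KM_of_mem_AMC ⟨a, ha, h.trans (le_abs_self _)⟩
    · refine (infDist_le_dist_of_mem hω₀).trans ?_
      rwa [dist_comm, Real.dist_eq, ← abs_of_nonneg him]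
  · have := eq_zero_of_zero_on_pos_measure (isClosed_AMR τ M) hpos (Z := fun z => D (Efn (-z)))
      (hD.comp (hEd.comp differentiable_neg).differentiableOn fun z hz => ?_) (fun a ha => ?_)
      (z := -ω) ?_
    · simpa using this
    · obtain ⟨a, ha, h⟩ := exists_mem_AMR_of_infDist_le hne hz
      refine mem_finPart_KM_of_mem_AMC ⟨-a, neg_mem_AMR ha, ?_⟩
      rw [Complex.neg_re, Complex.neg_im, abs_neg, neg_sub_neg, abs_sub_comm]
      exact h.trans (le_abs_self _)
    · simpa using h0 (-a) (neg_mem_AMR ha)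
    · refine (infDist_le_dist_of_mem (neg_mem_AMR hω₀)).trans ?_
      rw [Real.dist_eq, Complex.neg_re, Complex.neg_im, neg_sub_neg, ← abs_of_nonpos him]
      exact hω

theorem FPair.sub_sub_mul_le {K : Set ℂ} {S : Set α} {u g : ℂ → α → ℂ} (h : FPair K S u g)
    {q : ℂ} (hq : q ∈ K) {ε : ℝ} (hε : 0 < ε) : ∃ δ > (0 : ℝ), ∀ q' ∈ K, dist q' q < δ →
      ∀ a ∈ S, ‖u q' a - u q a - (q' - q) * g q a‖ ≤ ε * dist q' q := by
  obtain ⟨δ, hδ, H⟩ := h.2.2 (q, q) ⟨hq, hq⟩ ε hε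
  refine ⟨δ, hδ, fun q' hq' hd a ha => ?_⟩
  rcases eq_or_ne q' q with rfl | hne
  · simp
  have h1 := H (q, q') ⟨hq, hq'⟩ (by simpa [Prod.dist_eq, hδ] using hd) a ha
  simp only [omegaF, if_neg hne.symm, if_true, sub_zero, smul_eq_mul] at h1
  have h0 : q' - q ≠ 0 := sub_ne_zero.2 hne
  have h2 : u q' a - u q a - (q' - q) * g q a =
      (q' - q) * ((q' - q)⁻¹ * (u q' a - u q a) - g q a) := by
    field_simp
  rw [h2, norm_mul, mul_comm, dist_eq_norm]
  gcongr

open Classical in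
/-- A function, as an element of `valHolSubmodule` when it is one, and `0` otherwise. -/
def toValHol (R ρ : ℝ) (w : ℂ × ℂ → ℂ) : valHolSubmodule R ρ :=
  if h : ValHol R ρ w then ⟨w, h⟩ else 0

theorem toValHol_coe {R ρ : ℝ} {w : ℂ × ℂ → ℂ} (h : ValHol R ρ w) :
    (toValHol R ρ w).1 = w := by
  rw [toValHol, dif_pos h]

theorem taylorMap_congr {R ρ : ℝ} (hR : 0 < R) (hρ : 0 < ρ) {v w : ℂ × ℂ → ℂ}
    (hv : ValHol R ρ v) (hw : ValHol R ρ w) (h : ∀ pt ∈ SD R ρ, v pt = w pt) (n : ℕ) :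
    taylorMap hR hρ n (toValHol R ρ v) = taylorMap hR hρ n (toValHol R ρ w) := by
  ext x
  obtain ⟨θ, rfl⟩ := QuotientAddGroup.mk_surjective x
  change taylorCoeff n _ = taylorCoeff n _
  rw [toValHol_coe hv, toValHol_coe hw]
  refine taylorCoeff_congr ?_ n
  filter_upwards [ball_mem_nhds (0 : ℂ) hρ] with ε hε
  exact h _ ⟨ofReal_mem_Strip hR θ, hε⟩

theorem compl_singleton_mem_nhdsNE (z w : ℂ) : {w}ᶜ ∈ 𝓝[≠] z := by
  rcases eq_or_ne z w with rfl | h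
  · exact self_mem_nhdsWithin
  · exact nhdsWithin_le_nhds (isOpen_compl_singleton.mem_nhds h)

/-- A function differentiable for the sup norm at the points of `finPart K_M` and given on
the circle by the solutions of the conjugacy equation has no analytic continuation across the
circle. -/
theorem false_of_continuation {τ R R' M ρ : ℝ} (hτ : 0 < τ) (hR : 0 < R) (hR' : 0 < R')
    (hM : 2 * zetaR (1 + τ) < M) (hρ : 0 < ρ) {F : ℂ → ℂ} (hFper : ∀ z : ℂ, F (z + 1) = F z)
    (hFdiff : DifferentiableOn ℂ F (Strip R')) (hFreal : ∀ x : ℝ, (F (x : ℂ)).im = 0)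
    (hFmean : (∫ t in (0 : ℝ)..1, F t) = 0) (hFne : ∃ x : ℝ, F (x : ℂ) ≠ 0)
    {u : ℂ → ℂ × ℂ → ℂ} {g : ℂ → ℂ × ℂ → ℂ} (hu : FPair (finPart (KM τ M)) (SD R ρ) u g)
    (huv : ∀ q ∈ finPart (KM τ M), ValHol R ρ (u q))
    (hmean : ∀ ω ∈ AMR τ M, (∫ t in (0 : ℝ)..1, u (Efn (ω : ℂ)) ((t : ℂ), 0)) = 0)
    (heq : ∀ ω ∈ AMR τ M, ∀ ε : ℝ, |ε| < ρ → ∀ θ : ℝ,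
      u (Efn (ω : ℂ)) ((θ : ℂ) + ω, (ε : ℂ)) - 2 * u (Efn (ω : ℂ)) ((θ : ℂ), (ε : ℂ)) +
        u (Efn (ω : ℂ)) ((θ : ℂ) - ω, (ε : ℂ)) =
          ε * F (θ + u (Efn (ω : ℂ)) ((θ : ℂ), (ε : ℂ))))
    {qs : ℂ} (hqs : ‖qs‖ = 1) {U V : Set ℂ} {gg : ℂ → ℂ × ℂ → ℂ} (hU : IsOpen U)
    (hUc : IsConnected U) (hqU : qs ∈ U) (hgg : BHolOn R ρ U gg) (hV : IsOpen V)
    (hVne : V.Nonempty) (hVU : V ⊆ U) (hVK : V ⊆ finPart (KM τ M))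
    (hVeq : ∀ q ∈ V, ∀ pt ∈ SD R ρ, gg q pt = u q pt) : False := by
  obtain ⟨Φ, hΦ, hΦf⟩ := exists_circle_iteratedDeriv hR' hFper hFdiff
  have hM0 : 0 < M := by linarith [one_le_zetaR (s := 1 + τ) (by linarith)]
  have hΦ0 : ∀ θ : ℝ, Φ 0 (θ : UnitAddCircle) = F θ := fun θ => by
    rw [hΦ, iteratedDeriv_zero]
  obtain ⟨hgv, -, g', hg'⟩ := hgg
  set Gu : ℂ → ℕ → C(UnitAddCircle, ℂ) := fun q n => taylorMap hR hρ n (toValHol R ρ (u q))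
  set G : ℂ → ℕ → C(UnitAddCircle, ℂ) := fun q n => taylorMap hR hρ n (toValHol R ρ (gg q))
  have hGu : ∀ n, DifferentiableOn ℂ (fun q => Gu q n) (finPart (KM τ M)) := fun n => by
    refine differentiableOn_taylorMap hR hρ n (v' := g) fun q hq ε hε => ?_
    obtain ⟨δ, hδ, H⟩ := hu.sub_sub_mul_le hq hε
    refine ⟨δ, hδ, fun q' hq' hd pt hpt => ?_⟩
    rw [toValHol_coe (huv q hq), toValHol_coe (huv q' hq')]
    exact H q' hq' hd pt hpt
  have hG : ∀ n, DifferentiableOn ℂ (fun q => G q n) U := fun n => by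
    refine differentiableOn_taylorMap hR hρ n (v' := g') fun q hq ε hε => ?_
    obtain ⟨δ, hδ, H⟩ := hg' q hq ε hε
    refine ⟨δ, hδ, fun q' hq' hd pt hpt => ?_⟩
    rw [toValHol_coe (hgv q hq), toValHol_coe (hgv q' hq')]
    exact H q' hq' hd pt hpt
  have hDu : ∀ n l, ∀ q ∈ finPart (KM τ M), q ≠ 0 → recursionDefect Φ Gu n l q = 0 :=
    fun n l q hq hq0 => by
      refine eq_zero_on_finPart_KM hτ hM (differentiableOn_recursionDefect hGu n l)
        (fun ω hω => ?_) hq hq0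
      have hωK : Efn (ω : ℂ) ∈ finPart (KM τ M) :=
        mem_finPart_KM_of_mem_AMC ⟨ω, hω, by simp⟩
      have h := recursion_of_conjugacy hR hρ hR' hFdiff hΦ
        (fun k hk => Efn_pow_ne_one hM0 hω hk) (toValHol R ρ (u (Efn (ω : ℂ))))
        (by rw [toValHol_coe (huv _ hωK)]; exact hmean ω hω)
        (by rw [toValHol_coe (huv _ hωK)]; exact heq ω hω) n l
      rw [zpow_natCast] at h
      exact sub_eq_zero.2 h
  have hD : ∀ n l, ∀ q ∈ U, recursionDefect Φ G n l q = 0 := fun n l => by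
    obtain ⟨z, hz⟩ := hVne
    refine ((differentiableOn_recursionDefect hG n l).analyticOnNhd
      hU).eqOn_zero_of_preconnected_of_frequently_eq_zero hUc.isPreconnected (hVU hz)
      (Eventually.frequently ?_)
    filter_upwards [nhdsWithin_le_nhds (hV.mem_nhds hz), compl_singleton_mem_nhdsNE z 0]
      with q hq hq0
    have hGq : G q = Gu q := funext fun n =>
      taylorMap_congr hR hρ (hgv q (hVU hq)) (huv q (hVK hq)) (hVeq q hq) n
    rw [← hDu n l q (hVK hq) hq0, recursionDefect, recursionDefect, hGq]
  refine false_of_recursion_of_mem_circle (F := Φ) hΦf ?_ ?_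
    (fourierFunctional_neg_of_real fun θ => by rw [hΦ0, hFreal]) hU hqs hqU (G := G)
    (fun n => (hG n).continuousOn) fun q hq n l _ => sub_eq_zero.1 (hD n l q hq)
  · obtain ⟨x, hx⟩ := hFne
    intro h
    exact hx (by rw [← hΦ0, h]; rfl)
  · rw [fourierFunctional_eq_intervalIntegral]
    simpa [hΦ0] using hFmean

/-- The unit circle is a natural boundary: if `ũ_M` is the
function given by the complexified KAM theorem, then its restriction to
`K̊_M^{(i)}` (resp. `K̊_M^{(e)}`) — which is a `B_{R,ρ}`-valued holomorphic
function — admits no analytic continuation in the Weierstraß sense in any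
neighbourhood of any point `q*` of the unit circle. -/
theorem no_analytic_continuation (τ R R₀ R₁ M ρ : ℝ) (hτ : 0 < τ) (hR : 0 < R)
    (hRR : R < R₀) (hR₁ : R₀ < R₁) (hM : 2 * zetaR (1 + τ) < M) (hρ : 0 < ρ)
    (F : ℂ → ℂ)
    (hFper : ∀ z : ℂ, F (z + 1) = F z)
    (hFdiff : DifferentiableOn ℂ F (Strip R₁))
    (hFbdd : ∃ C : ℝ, ∀ z ∈ Strip R₁, ‖F z‖ ≤ C)
    (hFreal : ∀ x : ℝ, (F (x : ℂ)).im = 0)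
    (hFmean : (∫ t in (0:ℝ)..1, F t) = 0)
    (hFne : ∃ x : ℝ, F (x : ℂ) ≠ 0)
    -- `ũ_M ∈ C¹_hol(K_M, B_{R,ρ})` is given by the complexified KAM theorem:
    (u : OnePoint ℂ → ℂ × ℂ → ℂ) (g h : ℂ → ℂ × ℂ → ℂ)
    (hu : MemC τ M R ρ u g h)
    (hKAM : ∀ ω ∈ AMR τ M, ∀ ε : ℝ, |ε| < ρ →
      ((∫ t in (0:ℝ)..1, u ((Efn (ω : ℂ)) : OnePoint ℂ) ((t : ℂ), (ε : ℂ))) = 0 ∧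
       Function.Injective (fun θ : ℝ =>
         θ + (u ((Efn (ω : ℂ)) : OnePoint ℂ) ((θ : ℂ), (ε : ℂ))).re) ∧
       ∀ θ : ℝ,
         u ((Efn (ω : ℂ)) : OnePoint ℂ) (((θ : ℂ) + (ω : ℂ)), (ε : ℂ)) -
             2 * u ((Efn (ω : ℂ)) : OnePoint ℂ) ((θ : ℂ), (ε : ℂ)) +
             u ((Efn (ω : ℂ)) : OnePoint ℂ) (((θ : ℂ) - (ω : ℂ)), (ε : ℂ)) =
           (ε : ℂ) * F ((θ : ℂ) + u ((Efn (ω : ℂ)) : OnePoint ℂ) ((θ : ℂ), (ε : ℂ))))) :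
    ∀ qs : ℂ, ‖qs‖ = 1 →
      (¬ ∃ (U : Set ℂ) (gg : ℂ → ℂ × ℂ → ℂ),
        IsOpen U ∧ IsConnected U ∧ qs ∈ U ∧ (U ∩ KMintIn τ M).Nonempty ∧
        BHolOn R ρ U gg ∧
        ∃ V : Set ℂ, IsOpen V ∧ V.Nonempty ∧ V ⊆ U ∩ KMintIn τ M ∧
          ∀ q ∈ V, ∀ pt ∈ SD R ρ, gg q pt = u (q : OnePoint ℂ) pt) ∧
      (¬ ∃ (U : Set ℂ) (gg : ℂ → ℂ × ℂ → ℂ),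
        IsOpen U ∧ IsConnected U ∧ qs ∈ U ∧ (U ∩ KMintEx τ M).Nonempty ∧
        BHolOn R ρ U gg ∧
        ∃ V : Set ℂ, IsOpen V ∧ V.Nonempty ∧ V ⊆ U ∩ KMintEx τ M ∧
          ∀ q ∈ V, ∀ pt ∈ SD R ρ, gg q pt = u (q : OnePoint ℂ) pt) := by
  have hR' : 0 < R₁ := hR.trans (hRR.trans hR₁)
  have main : ∀ qs : ℂ, ‖qs‖ = 1 → ∀ W ⊆ finPart (KM τ M),
      ¬ ∃ (U : Set ℂ) (gg : ℂ → ℂ × ℂ → ℂ),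
        IsOpen U ∧ IsConnected U ∧ qs ∈ U ∧ (U ∩ W).Nonempty ∧ BHolOn R ρ U gg ∧
        ∃ V : Set ℂ, IsOpen V ∧ V.Nonempty ∧ V ⊆ U ∩ W ∧
          ∀ q ∈ V, ∀ pt ∈ SD R ρ, gg q pt = u (q : OnePoint ℂ) pt := by
    rintro qs hqs W hW ⟨U, gg, hU, hUc, hqU, -, hgg, V, hV, hVne, hVUW, hVeq⟩
    refine false_of_continuation hτ hR hR' hM hρ hFper hFdiff hFreal hFmean hFne hu.1.1
      (fun q hq => hu.2.2 q hq) (fun ω hω => ?_) (fun ω hω ε hε => (hKAM ω hω ε hε).2.2)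
      hqs hU hUc hqU hgg hV hVne (hVUW.trans inter_subset_left)
      ((hVUW.trans inter_subset_right).trans hW) hVeq
    simpa using (hKAM ω hω 0 (by simpa using hρ)).1
  exact fun qs hqs => ⟨main qs hqs _ fun q hq => interior_subset (s := KM τ M) hq.1,
    main qs hqs _ fun q hq => interior_subset (s := KM τ M) hq.1⟩
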